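/- arXiv:1205.1539 — 10 statements merged into one kernel-verified Lean document; each statement's English description precedes it below -/
import Mathlib

section
/- Let X be a compact Hausdorff topological space and let a group G act on X by homeomorphisms. If the skew group algebra C(X,ℂ) ⋊^σ G is a simple ring, then the action of G on X is minimal. -/
/-- The additive subgroup of a skew group algebra generated by the monomials `ι f * u g` with `f`
vanishing on `Y` is a two-sided ideal when `Y` is invariant. -/
def vanishingIdeal {X G R : Type*} [TopologicalSpace X] [Group G] [Ring R] (ρ : G → X ≃ₜ X)
    (ι : C(X, ℂ) →+* R) (u : G → R)
    (hu_mul : ∀ g h : G, u g * u h = u (g * h))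
    (hu_comm : ∀ (g : G) (f : C(X, ℂ)),
      u g * ι f = ι (f.comp (ρ g⁻¹ : C(X, X))) * u g)
    (hspan : ∀ r : R, ∃ a : G →₀ C(X, ℂ), (a.sum fun g f => ι f * u g) = r)
    (Y : Set X) (hY : ∀ g : G, ∀ y ∈ Y, ρ g y ∈ Y) : TwoSidedIdeal R :=
  TwoSidedIdeal.mk'
    (AddSubgroup.closure {r | ∃ (f : C(X, ℂ)) (g : G), (∀ y ∈ Y, f y = 0) ∧ ι f * u g = r})
    (zero_mem _) (fun hx hy => add_mem hx hy) (fun hx => neg_mem hx)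
    (by
      intro r x hx
      obtain ⟨a, rfl⟩ := hspan r
      induction hx using AddSubgroup.closure_induction with
      | mem x hx =>
        obtain ⟨f, g, hf, rfl⟩ := hx
        rw [Finsupp.sum, Finset.sum_mul]
        refine sum_mem fun h _ => AddSubgroup.subset_closure
          ⟨a h * f.comp (ρ h⁻¹ : C(X, X)), h * g, fun y hy => ?_, ?_⟩
        · simp [hf _ (hY h⁻¹ y hy)]
        · rw [map_mul, ← hu_mul, mul_assoc, ← mul_assoc _ (u h), ← hu_comm]
          simp only [mul_assoc]
      | zero => simp
      | add x y _ _ hx hy => rw [mul_add]; exact add_mem hx hy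
      | neg x _ hx => rw [mul_neg]; exact neg_mem hx)
    (by
      intro x r hx
      obtain ⟨a, rfl⟩ := hspan r
      induction hx using AddSubgroup.closure_induction with
      | mem x hx =>
        obtain ⟨f, g, hf, rfl⟩ := hx
        rw [Finsupp.sum, Finset.mul_sum]
        refine sum_mem fun h _ => AddSubgroup.subset_closure
          ⟨f * (a h).comp (ρ g⁻¹ : C(X, X)), g * h, fun y hy => ?_, ?_⟩
        · simp [hf y hy]
        · rw [map_mul, ← hu_mul, mul_assoc, ← mul_assoc _ (u g), ← hu_comm]
          simp only [mul_assoc]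
      | zero => simp
      | add x y _ _ hx hy => rw [add_mul]; exact add_mem hx hy
      | neg x _ hx => rw [neg_mul]; exact neg_mem hx)

/-- Every sum of monomials whose coefficients vanish on `Y` has a representation with all
coefficients vanishing on `Y`. -/
theorem exists_coeff_vanishing_of_mem_closure {X G R : Type*} [TopologicalSpace X] [Ring R]
    (ι : C(X, ℂ) →+* R) (u : G → R) (Y : Set X) {r : R}
    (hr : r ∈ AddSubgroup.closure
      {r | ∃ (f : C(X, ℂ)) (g : G), (∀ y ∈ Y, f y = 0) ∧ ι f * u g = r}) :
    ∃ a : G →₀ C(X, ℂ), (∀ g, ∀ y ∈ Y, a g y = 0) ∧ (a.sum fun g f => ι f * u g) = r := by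
  classical
  induction hr using AddSubgroup.closure_induction with
  | mem x hx =>
    obtain ⟨f, g, hf, rfl⟩ := hx
    refine ⟨Finsupp.single g f, fun h y hy => ?_, by simp⟩
    rw [Finsupp.single_apply]
    split_ifs
    · exact hf y hy
    · rfl
  | zero => exact ⟨0, fun _ _ _ => rfl, by simp⟩
  | add x y _ _ hx hy =>
    obtain ⟨a, ha, rfl⟩ := hx
    obtain ⟨b, hb, rfl⟩ := hy
    refine ⟨a + b, fun g y hy => by simp [ha g y hy, hb g y hy], ?_⟩
    exact Finsupp.sum_add_index' (by simp) (by simp [add_mul])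
  | neg x _ hx =>
    obtain ⟨a, ha, rfl⟩ := hx
    refine ⟨-a, fun g y hy => by simp [ha g y hy], ?_⟩
    rw [Finsupp.sum_neg_index (by simp)]
    simp [Finsupp.sum]

/-- Let `X` be a compact Hausdorff space and let a group `G` act on `X`
by homeomorphisms (given by `ρ : G → X ≃ₜ X` respecting the group structure).
The skew group algebra `C(X,ℂ) ⋊^σ G` is modelled as a ring `R` together with a ring
homomorphism `ι : C(X,ℂ) →+* R` and elements `u g` satisfying the skew commutation
relation `u g * ι f = ι (f ∘ (ρ g)⁻¹) * u g`, such that `R` is free as a left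
`C(X,ℂ)`-module with basis `{u g}` (expressed by bijectivity of the representation map).
If `R` is a simple ring, then the action of `G` on `X` is minimal. -/
theorem skew_group_algebra_simple_implies_minimal
    {X : Type*} [TopologicalSpace X] [CompactSpace X] [T2Space X]
    {G : Type*} [Group G] (ρ : G → X ≃ₜ X)
    (hρ_one : ρ 1 = Homeomorph.refl X)
    (hρ_mul : ∀ g h : G, ρ (g * h) = (ρ h).trans (ρ g))
    {R : Type*} [Ring R] (ι : C(X, ℂ) →+* R) (u : G → R)
    (hu_one : u 1 = 1)
    (hu_mul : ∀ g h : G, u g * u h = u (g * h))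
    (hu_comm : ∀ (g : G) (f : C(X, ℂ)),
      u g * ι f = ι (f.comp (ρ g⁻¹ : C(X, X))) * u g)
    (hfree : Function.Bijective
      (fun a : G →₀ C(X, ℂ) => a.sum fun g f => ι f * u g))
    (hsimple : IsSimpleRing R) :
    ¬ ∃ Y : Set X, Y.Nonempty ∧ Y ≠ Set.univ ∧ IsClosed Y ∧
      ∀ g : G, (ρ g) '' Y ⊆ Y := by
  rintro ⟨Y, ⟨y, hy⟩, hne, hclosed, hinv⟩
  obtain ⟨x, hx⟩ := (Set.ne_univ_iff_exists_notMem Y).1 hne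
  obtain ⟨k, hk0, hk1, -⟩ := exists_continuous_zero_one_of_isClosed hclosed
    (isClosed_singleton (x := x)) (Set.disjoint_singleton_right.2 hx)
  let f : C(X, ℂ) := ⟨fun z => (k z : ℂ), by fun_prop⟩
  let J := vanishingIdeal ρ ι u hu_mul hu_comm hfree.surjective Y
    fun g y hy => hinv g ⟨y, hy, rfl⟩
  have hmem (r : R) : r ∈ J ↔ r ∈ AddSubgroup.closure
      {r | ∃ (f : C(X, ℂ)) (g : G), (∀ y ∈ Y, f y = 0) ∧ ι f * u g = r} :=
    TwoSidedIdeal.mem_mk' ..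
  have hfJ : ι f ∈ J := (hmem _).2 <| AddSubgroup.subset_closure
    ⟨f, 1, fun y hy => by simp [f, hk0 hy], by rw [hu_one, mul_one]⟩
  rcases hsimple.simple.eq_bot_or_eq_top J with hJ | hJ
  · rw [hJ, TwoSidedIdeal.mem_bot] at hfJ
    have hsingle : Finsupp.single (1 : G) f = 0 := hfree.injective (by simp [hfJ])
    have hfx : f x = 0 := by rw [Finsupp.single_eq_zero.1 hsingle]; rfl
    simp [f, hk1 rfl] at hfx
  · have h_one : (1 : R) ∈ J := by rw [hJ]; trivial
    obtain ⟨a, ha, hsum⟩ := exists_coeff_vanishing_of_mem_closure ι u Y ((hmem 1).1 h_one)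
    have hsingle : a = Finsupp.single (1 : G) 1 :=
      hfree.injective (by simp [hsum, hu_one])
    have := ha 1 y hy
    simp [hsingle] at this
end

section
/- Let X be a compact Hausdorff topological space and let a group G act on X by homeomorphisms. If the skew group algebra C(X,ℂ) ⋊^σ G is a simple ring, then the action of G on X is faithful. -/
/-- The additive endomorphism `k ↦ f * (k ∘ φ)` of `C(X, ℂ)`. -/
noncomputable def weightedComp {X : Type*} [TopologicalSpace X] (f : C(X, ℂ)) (φ : C(X, X)) :
    AddMonoid.End C(X, ℂ) :=
  AddMonoidHom.mk' (fun k => f * k.comp φ) fun a b => by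
    ext x
    simp [mul_add]

@[simp]
theorem weightedComp_apply {X : Type*} [TopologicalSpace X] (f : C(X, ℂ)) (φ : C(X, X))
    (k : C(X, ℂ)) : weightedComp f φ k = f * k.comp φ := rfl

theorem weightedComp_mul {X : Type*} [TopologicalSpace X] (f f' : C(X, ℂ)) (φ φ' : C(X, X)) :
    weightedComp f φ * weightedComp f' φ' = weightedComp (f * f'.comp φ) (φ'.comp φ) := by
  ext k x
  simp [mul_assoc]

theorem weightedComp_one_id {X : Type*} [TopologicalSpace X] :
    weightedComp (1 : C(X, ℂ)) (ContinuousMap.id X) = 1 := by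
  ext k x
  simp

/-- `weightedComp` as an additive map in the weight. -/
noncomputable def weightedCompHom {X : Type*} [TopologicalSpace X] (φ : C(X, X)) :
    C(X, ℂ) →+ AddMonoid.End C(X, ℂ) :=
  AddMonoidHom.mk' (fun f => weightedComp f φ) fun a b => by
    ext k : 1
    exact add_mul a b (k.comp φ)

/-- A skew group ring of `C(X, ℂ)` acts on `C(X, ℂ)` through the covariant representation. -/
theorem exists_ringHom_weightedComp
    {X : Type*} [TopologicalSpace X] {G : Type*} [Group G] (ρ : G → X ≃ₜ X)
    (hρ_one : ρ 1 = Homeomorph.refl X)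
    (hρ_mul : ∀ g h : G, ρ (g * h) = (ρ h).trans (ρ g))
    {R : Type*} [Ring R] (ι : C(X, ℂ) →+* R) (u : G → R)
    (hu_one : u 1 = 1)
    (hu_mul : ∀ g h : G, u g * u h = u (g * h))
    (hu_comm : ∀ (g : G) (f : C(X, ℂ)),
      u g * ι f = ι (f.comp (ρ g⁻¹ : C(X, X))) * u g)
    (hfree : Function.Bijective
      (fun a : G →₀ C(X, ℂ) => a.sum fun g f => ι f * u g)) :
    ∃ ψ : R →+* AddMonoid.End C(X, ℂ),
      ∀ (f : C(X, ℂ)) (g : G), ψ (ι f * u g) = weightedComp f (ρ g⁻¹ : C(X, X)) := by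
  let e : (G →₀ C(X, ℂ)) →+ R :=
    Finsupp.liftAddHom fun g => (AddMonoidHom.mulRight (u g)).comp ι.toAddMonoidHom
  have he : Function.Bijective e := hfree
  have he_single (g : G) (f : C(X, ℂ)) : e (Finsupp.single g f) = ι f * u g := by
    simp [e]
  let E : (G →₀ C(X, ℂ)) ≃+ R := AddEquiv.ofBijective e he
  let Φ : (G →₀ C(X, ℂ)) →+ AddMonoid.End C(X, ℂ) :=
    Finsupp.liftAddHom fun g => weightedCompHom (ρ g⁻¹ : C(X, X))
  let ψ : R →+ AddMonoid.End C(X, ℂ) := Φ.comp E.symm.toAddMonoidHom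
  have hψ (f : C(X, ℂ)) (g : G) : ψ (ι f * u g) = weightedComp f (ρ g⁻¹ : C(X, X)) := by
    have : E.symm (ι f * u g) = Finsupp.single g f := by
      rw [AddEquiv.symm_apply_eq]
      exact (he_single g f).symm
    change Φ (E.symm (ι f * u g)) = _
    rw [this]
    exact Finsupp.liftAddHom_apply_single _ g f
  have span_induction {p : R → Prop} (zero : p 0) (add : ∀ r s, p r → p s → p (r + s))
      (basis : ∀ f g, p (ι f * u g)) (r : R) : p r := by
    obtain ⟨a, rfl⟩ := he.2 r
    induction a using Finsupp.induction_linear with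
    | zero => simpa using zero
    | add a b ha hb => simpa using add _ _ ha hb
    | single g f => simpa [he_single] using basis f g
  have map_one : ψ 1 = 1 := by
    have h := hψ 1 1
    rw [hu_one, ι.map_one, mul_one, inv_one, hρ_one] at h
    rw [h]
    exact weightedComp_one_id
  have map_mul (r s : R) : ψ (r * s) = ψ r * ψ s := by
    refine span_induction (p := fun r => ψ (r * s) = ψ r * ψ s) ?_ ?_ (fun f g => ?_) r
    · simp
    · intro a b ha hb
      rw [add_mul, ψ.map_add, ha, hb, ψ.map_add]
      rfl
    refine span_induction (p := fun s => ψ (ι f * u g * s) = ψ (ι f * u g) * ψ s)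
      ?_ ?_ (fun f' g' => ?_) s
    · simp
    · intro a b ha hb
      rw [mul_add, ψ.map_add, ha, hb, ψ.map_add]
      ext k : 1
      exact ((ψ (ι f * u g)).map_add (ψ a k) (ψ b k)).symm
    have hprod : ι f * u g * (ι f' * u g') =
        ι (f * f'.comp (ρ g⁻¹ : C(X, X))) * u (g * g') := by
      rw [ι.map_mul, ← hu_mul, mul_assoc, ← mul_assoc (u g), hu_comm]
      simp only [mul_assoc]
    rw [hprod, hψ, hψ, hψ, weightedComp_mul, mul_inv_rev, hρ_mul]
    rfl
  exact ⟨{ ψ with map_one' := map_one, map_mul' := map_mul }, hψ⟩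

/-- If the skew group algebra `C(X,ℂ) ⋊^σ G` of a group `G` acting by
homeomorphisms on a compact Hausdorff space `X` is a simple ring, then
the action of `G` on `X` is faithful. -/
theorem skew_group_algebra_simple_implies_faithful
    {X : Type*} [TopologicalSpace X] [CompactSpace X] [T2Space X]
    {G : Type*} [Group G] (ρ : G → X ≃ₜ X)
    (hρ_one : ρ 1 = Homeomorph.refl X)
    (hρ_mul : ∀ g h : G, ρ (g * h) = (ρ h).trans (ρ g))
    {R : Type*} [Ring R] (ι : C(X, ℂ) →+* R) (u : G → R)
    (hu_one : u 1 = 1)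
    (hu_mul : ∀ g h : G, u g * u h = u (g * h))
    (hu_comm : ∀ (g : G) (f : C(X, ℂ)),
      u g * ι f = ι (f.comp (ρ g⁻¹ : C(X, X))) * u g)
    (hfree : Function.Bijective
      (fun a : G →₀ C(X, ℂ) => a.sum fun g f => ι f * u g))
    (hsimple : IsSimpleRing R) :
    ∀ g : G, g ≠ 1 → ∃ x : X, ρ g x ≠ x := by
  intro g hg
  by_contra! htriv
  obtain ⟨ψ, hψ⟩ := exists_ringHom_weightedComp ρ hρ_one hρ_mul ι u hu_one hu_mul hu_comm hfree
  have : Nontrivial C(X, ℂ) := ι.domain_nontrivial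
  have : Nontrivial (AddMonoid.End C(X, ℂ)) :=
    ⟨0, 1, fun h => zero_ne_one (DFunLike.congr_fun h (1 : C(X, ℂ)))⟩
  have hinv : ρ g⁻¹ = Homeomorph.refl X := by
    ext x
    have h := congrArg (fun φ => φ x) (hρ_mul g⁻¹ g)
    simpa [hρ_one, htriv] using h.symm
  have hψg : ψ (ι 1 * u g) = ψ (ι 1 * u 1) := by
    rw [hψ, hψ, hinv, inv_one, hρ_one]
  have heq : ι 1 * u g = ι 1 * u 1 := ψ.injective hψg
  have hsingle : Finsupp.single g (1 : C(X, ℂ)) = Finsupp.single 1 1 :=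
    hfree.1 (by simpa using heq)
  exact hg (Finsupp.single_left_injective one_ne_zero hsingle)
end

section
/- Let X be an infinite compact Hausdorff topological space, let T : X → X be a homeomorphism, and consider the induced action of the group ℤ on X in which n ∈ ℤ acts as T^n. Then the skew group algebra C(X,ℂ) ⋊^σ ℤ is a simple ring if and only if the action of ℤ on X is minimal, i.e. there is no nonempty proper closed subset Y ⊆ X with T^n(Y) ⊆ Y for all n ∈ ℤ. -/
section SkewGroupAlgebra

variable {X : Type*} [TopologicalSpace X]

theorem Homeomorph.continuous_toEquiv_zpow (T : X ≃ₜ X) (n : ℤ) :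
    Continuous (T.toEquiv ^ n : Equiv.Perm X) := by
  have h (k : ℕ) (S : X ≃ₜ X) : Continuous (S.toEquiv ^ k : Equiv.Perm X) := by
    induction k with
    | zero => exact continuous_id
    | succ k ih =>
      rw [pow_succ, Equiv.Perm.coe_mul]
      exact ih.comp S.continuous
  obtain ⟨k, rfl | rfl⟩ := n.eq_nat_or_neg
  · simpa using h k T
  · rw [zpow_neg, ← inv_zpow, zpow_natCast]
    exact h k T.symm

/-- The automorphism `f ↦ f ∘ T^(-m)` of `C(X, ℂ)`. -/
noncomputable def ContinuousMap.translate (T : X ≃ₜ X) (m : ℤ) (f : C(X, ℂ)) : C(X, ℂ) :=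
  ⟨fun x => f ((T.toEquiv ^ (-m)) x), f.continuous.comp (T.continuous_toEquiv_zpow (-m))⟩

@[simp]
theorem ContinuousMap.translate_apply (T : X ≃ₜ X) (m : ℤ) (f : C(X, ℂ)) (x : X) :
    f.translate T m x = f ((T.toEquiv ^ (-m)) x) := rfl

/-- Without nonempty proper closed invariant subsets, an infinite Hausdorff space has no
periodic points. -/
theorem zpow_apply_injective_of_minimal [T2Space X] [Infinite X] (T : X ≃ₜ X)
    (hT : ¬ ∃ Y : Set X, Y.Nonempty ∧ Y ≠ Set.univ ∧ IsClosed Y ∧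
      ∀ n : ℤ, (T.toEquiv ^ n) '' Y ⊆ Y) (x : X) :
    Function.Injective fun n : ℤ => (T.toEquiv ^ n) x := by
  intro m n (hmn : (T.toEquiv ^ m) x = (T.toEquiv ^ n) x)
  by_contra hne
  set p : ℤ := m - n with hp
  have hp0 : p ≠ 0 := sub_ne_zero.mpr hne
  have hpx : (T.toEquiv ^ p) x = x := by
    rw [hp, sub_eq_neg_add, zpow_add, Equiv.Perm.mul_apply, hmn, ← Equiv.Perm.mul_apply,
      ← zpow_add, neg_add_cancel, zpow_zero, Equiv.Perm.one_apply]
  have hfin : (Set.range fun k : ℤ => (T.toEquiv ^ k) x).Finite := by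
    refine ((Set.finite_Ico (0 : ℤ) |p|).image fun k : ℤ => (T.toEquiv ^ k) x).subset ?_
    rintro _ ⟨k, rfl⟩
    refine ⟨k % p, ⟨Int.emod_nonneg k hp0, Int.emod_lt_abs k hp0⟩, ?_⟩
    change (T.toEquiv ^ (k % p)) x = (T.toEquiv ^ k) x
    conv_rhs => rw [← Int.emod_add_mul_ediv k p, zpow_add, Equiv.Perm.mul_apply, zpow_mul,
      Equiv.Perm.zpow_apply_eq_self_of_apply_eq_self hpx]
  refine hT ⟨_, Set.range_nonempty _, fun h => ?_, hfin.isClosed, ?_⟩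
  · exact Set.infinite_univ (h ▸ hfin)
  · rintro k _ ⟨_, ⟨j, rfl⟩, rfl⟩
    exact ⟨k + j, by simp [zpow_add]⟩

/-- An ideal of `C(X, ℂ)` without common zeros is the whole ring. -/
theorem ContinuousMap.ideal_eq_top_of_forall_exists_ne_zero [CompactSpace X] [T2Space X]
    (J : Ideal C(X, ℂ)) (hJ : ∀ x, ∃ f ∈ J, f x ≠ 0) : J = ⊤ := by
  by_contra h
  obtain ⟨M, hM, hJM⟩ := J.exists_le_maximal h
  obtain ⟨x, hx⟩ := (ContinuousMap.ideal_isMaximal_iff M).mp hM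
  obtain ⟨f, hf, hfx⟩ := hJ x
  have := hJM hf
  rw [← hx, ContinuousMap.mem_idealOfSet] at this
  exact hfx (this (by simp))

variable {R : Type*} [Ring R] (ι : C(X, ℂ) →+* R) (u : ℤ → R)

/-- The additive map `∑ aₙ ↦ ∑ ι aₙ * uₙ`. -/
noncomputable def skewSum : (ℤ →₀ C(X, ℂ)) →+ R :=
  Finsupp.liftAddHom fun n => (AddMonoidHom.mulRight (u n)).comp ι.toAddMonoidHom

theorem skewSum_apply (a : ℤ →₀ C(X, ℂ)) : skewSum ι u a = a.sum fun n f => ι f * u n := rfl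

theorem skewSum_single (n : ℤ) (f : C(X, ℂ)) :
    skewSum ι u (Finsupp.single n f) = ι f * u n := by
  simp [skewSum]

variable {ι u} {T : X ≃ₜ X}

theorem skewSum_mul_sub_mul_skewSum
    (hu_comm : ∀ (m : ℤ) (f : C(X, ℂ)), u m * ι f = ι (f.translate T m) * u m)
    (a : ℤ →₀ C(X, ℂ)) (f g : C(X, ℂ)) :
    skewSum ι u (Finsupp.onFinset a.support (fun k => a k * (f.translate T k - g))
        (fun _ hk => Finsupp.mem_support_iff.mpr (left_ne_zero_of_mul hk))) =
      skewSum ι u a * ι f - ι g * skewSum ι u a := by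
  rw [skewSum_apply, skewSum_apply, Finsupp.onFinset_sum _ (by simp), Finsupp.sum,
    Finset.sum_mul, Finset.mul_sum, ← Finset.sum_sub_distrib]
  refine Finset.sum_congr rfl fun k _ => ?_
  rw [mul_assoc _ (u k), hu_comm, ← mul_assoc, ← mul_assoc, ← map_mul, ← map_mul, ← sub_mul,
    ← map_sub, mul_sub, mul_comm g]

/-- If a two-sided ideal contains an element with a coefficient not vanishing at a nonperiodic
point `x`, then it contains an element of `C(X, ℂ)` not vanishing at `x`. -/
theorem exists_apply_ne_zero_and_mem_twoSidedIdeal [CompactSpace X] [T2Space X]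
    (hu_zero : u 0 = 1) (hu_add : ∀ m n : ℤ, u m * u n = u (m + n))
    (hu_comm : ∀ (m : ℤ) (f : C(X, ℂ)), u m * ι f = ι (f.translate T m) * u m)
    (I : TwoSidedIdeal R) (x : X) (hx : Function.Injective fun n : ℤ => (T.toEquiv ^ n) x)
    (n : ℤ) (a : ℤ →₀ C(X, ℂ)) (ha : a n x ≠ 0) (haI : skewSum ι u a ∈ I) :
    ∃ f : C(X, ℂ), f x ≠ 0 ∧ ι f ∈ I := by
  suffices H : ∀ (s : Finset ℤ) (a : ℤ →₀ C(X, ℂ)), a.support ⊆ insert n s → a n x ≠ 0 →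
      skewSum ι u a ∈ I → ∃ f : C(X, ℂ), f x ≠ 0 ∧ ι f ∈ I from
    H a.support a (Finset.subset_insert _ _) ha haI
  intro s
  induction s using Finset.induction_on with
  | empty =>
    intro a hs ha haI
    refine ⟨a n, ha, ?_⟩
    have hsingle : a = Finsupp.single n (a n) :=
      Finsupp.support_subset_singleton.mp (by simpa using hs)
    rw [hsingle, skewSum_single] at haI
    have := I.mul_mem_right _ (u (-n)) haI
    rwa [mul_assoc, hu_add, add_neg_cancel, hu_zero, mul_one] at this
  | insert m s _ ih =>
    intro a hs ha haI
    obtain rfl | hmn := eq_or_ne m n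
    · exact ih a (by simpa using hs) ha haI
    have hne : (T.toEquiv ^ (-m)) x ≠ (T.toEquiv ^ (-n)) x :=
      fun h => hmn (neg_injective (hx h))
    obtain ⟨f, hf0, hf1, -⟩ := exists_continuous_zero_one_of_isClosed
      (isClosed_singleton (x := (T.toEquiv ^ (-m)) x))
      (isClosed_singleton (x := (T.toEquiv ^ (-n)) x)) (Set.disjoint_singleton.mpr hne)
    let F : C(X, ℂ) := ⟨fun y => (f y : ℂ), by fun_prop⟩
    have hF0 : F ((T.toEquiv ^ (-m)) x) = 0 := by simpa [F] using hf0 rfl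
    have hF1 : F ((T.toEquiv ^ (-n)) x) = 1 := by simpa [F] using hf1 rfl
    refine ih _ ?_ ?_ ((skewSum_mul_sub_mul_skewSum hu_comm a F (F.translate T m)).symm ▸
      I.sub_mem (I.mul_mem_right _ _ haI) (I.mul_mem_left _ _ haI))
    · intro k hk
      have hk' := Finsupp.mem_support_iff.mp hk
      rw [Finsupp.onFinset_apply] at hk'
      have hkm : k ≠ m := by
        rintro rfl
        simp at hk'
      have := hs (Finsupp.mem_support_iff.mpr (left_ne_zero_of_mul hk'))
      simpa [hkm] using this
    · rw [Finsupp.onFinset_apply, ContinuousMap.mul_apply, ContinuousMap.sub_apply,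
        ContinuousMap.translate_apply, ContinuousMap.translate_apply, hF0, hF1, sub_zero, mul_one]
      exact ha

theorem isSimpleRing_of_minimal [CompactSpace X] [T2Space X] [Infinite X]
    (hu_zero : u 0 = 1) (hu_add : ∀ m n : ℤ, u m * u n = u (m + n))
    (hu_comm : ∀ (m : ℤ) (f : C(X, ℂ)), u m * ι f = ι (f.translate T m) * u m)
    (hfree : Function.Bijective (skewSum ι u))
    (hT : ¬ ∃ Y : Set X, Y.Nonempty ∧ Y ≠ Set.univ ∧ IsClosed Y ∧
      ∀ n : ℤ, (T.toEquiv ^ n) '' Y ⊆ Y) : IsSimpleRing R := by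
  have : Nontrivial R := hfree.injective.nontrivial
  refine ⟨⟨fun I => or_iff_not_imp_left.mpr fun hI => ?_⟩⟩
  let J : Ideal C(X, ℂ) := (TwoSidedIdeal.asIdeal I).comap ι
  have hJ (f : C(X, ℂ)) : f ∈ J ↔ ι f ∈ I := by simp [J, Ideal.mem_comap]
  obtain ⟨r, hrI, hr⟩ : ∃ r ∈ I, r ≠ 0 := by
    by_contra! h
    exact hI (eq_bot_iff.mpr fun r hr => (TwoSidedIdeal.mem_bot R).mpr (h r hr))
  obtain ⟨a, rfl⟩ := hfree.surjective r
  obtain ⟨n, hn⟩ : ∃ n, a n ≠ 0 := by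
    by_contra! h
    exact hr (by rw [Finsupp.ext (g := 0) h, map_zero])
  obtain ⟨x, hx⟩ : ∃ x, a n x ≠ 0 := by
    by_contra! h
    exact hn (ContinuousMap.ext h)
  obtain ⟨b, hbx, hb⟩ := exists_apply_ne_zero_and_mem_twoSidedIdeal hu_zero hu_add hu_comm I x
    (zpow_apply_injective_of_minimal T hT x) n a hx hrI
  have hJtop : J = ⊤ := by
    refine ContinuousMap.ideal_eq_top_of_forall_exists_ne_zero J fun y => ?_
    by_contra! hy
    refine hT ⟨{z | ∀ f ∈ J, f z = 0}, ⟨y, hy⟩, fun h => ?_, ?_, ?_⟩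
    · exact hbx ((h ▸ Set.mem_univ x : x ∈ {z | ∀ f ∈ J, f z = 0}) b ((hJ b).mpr hb))
    · simp only [Set.ofPred_forall]
      exact isClosed_iInter fun f => isClosed_iInter fun _ =>
        isClosed_eq f.continuous continuous_const
    · rintro k _ ⟨z, hz, rfl⟩ f hf
      have hmem : f.translate T (-k) ∈ J := by
        have := I.mul_mem_right _ (u k) (I.mul_mem_left (u (-k)) _ ((hJ f).mp hf))
        rw [hu_comm, mul_assoc, hu_add, neg_add_cancel, hu_zero, mul_one] at this
        exact (hJ _).mpr this
      simpa using hz _ hmem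
  have h1 : ι 1 ∈ I := (hJ 1).mp (hJtop ▸ Submodule.mem_top)
  rw [map_one] at h1
  exact (TwoSidedIdeal.one_mem_iff I).mp h1

theorem minimal_of_isSimpleRing [CompactSpace X] [T2Space X]
    (hu_zero : u 0 = 1) (hu_add : ∀ m n : ℤ, u m * u n = u (m + n))
    (hu_comm : ∀ (m : ℤ) (f : C(X, ℂ)), u m * ι f = ι (f.translate T m) * u m)
    (hfree : Function.Bijective (skewSum ι u)) [IsSimpleRing R] :
    ¬ ∃ Y : Set X, Y.Nonempty ∧ Y ≠ Set.univ ∧ IsClosed Y ∧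
      ∀ n : ℤ, (T.toEquiv ^ n) '' Y ⊆ Y := by
  rintro ⟨Y, ⟨y, hy⟩, hne, hclosed, hinv⟩
  let A : AddSubgroup (ℤ →₀ C(X, ℂ)) :=
    { carrier := {a | ∀ n, ∀ z ∈ Y, a n z = 0}
      zero_mem' := fun _ _ _ => rfl
      add_mem' := fun ha hb n z hz => by simp [ha n z hz, hb n z hz]
      neg_mem' := fun ha n z hz => by simp [ha n z hz] }
  let K : AddSubgroup R := A.map (skewSum ι u)
  have hmul (a b : ℤ →₀ C(X, ℂ))
      (h : ∀ m n, ∀ z ∈ Y, a m z * b n ((T.toEquiv ^ (-m)) z) = 0) :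
      skewSum ι u a * skewSum ι u b ∈ K := by
    rw [skewSum_apply, skewSum_apply, Finsupp.sum, Finsupp.sum, Finset.sum_mul_sum]
    refine sum_mem fun m _ => sum_mem fun n _ =>
      ⟨Finsupp.single (m + n) (a m * (b n).translate T m), fun k z hz => ?_, ?_⟩
    · obtain rfl | hk := eq_or_ne (m + n) k
      · simpa using h m n z hz
      · simp [Finsupp.single_eq_of_ne' hk]
    · rw [skewSum_single, map_mul, ← hu_add, mul_assoc, ← mul_assoc _ (u m), ← hu_comm]
      simp only [mul_assoc]
  let I : TwoSidedIdeal R := TwoSidedIdeal.mk' K K.zero_mem K.add_mem K.neg_mem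
    (by
      rintro r _ ⟨b, hb, rfl⟩
      obtain ⟨a, rfl⟩ := hfree.surjective r
      exact hmul a b fun m n z hz => by rw [hb n _ (hinv (-m) ⟨z, hz, rfl⟩), mul_zero])
    (by
      rintro _ r ⟨a, ha, rfl⟩
      obtain ⟨b, rfl⟩ := hfree.surjective r
      exact hmul a b fun m n z hz => by rw [ha m z hz, zero_mul])
  have hI (r : R) : r ∈ I ↔ r ∈ K := TwoSidedIdeal.mem_mk' ..
  have hmem (f : C(X, ℂ)) : ι f ∈ I ↔ ∀ z ∈ Y, f z = 0 := by
    have hf : skewSum ι u (Finsupp.single 0 f) = ι f := by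
      rw [skewSum_single, hu_zero, mul_one]
    rw [hI, ← hf]
    refine ⟨?_, fun h => ⟨_, fun n z hz => ?_, rfl⟩⟩
    · rintro ⟨a, ha, haf⟩ z hz
      simpa [hfree.injective haf] using ha 0 z hz
    · obtain rfl | hn := eq_or_ne 0 n
      · simpa using h z hz
      · simp [Finsupp.single_eq_of_ne' hn]
  obtain ⟨x, hx⟩ := (Set.ne_univ_iff_exists_notMem Y).mp hne
  obtain ⟨f, hf0, hf1, -⟩ := exists_continuous_zero_one_of_isClosed hclosed
    (isClosed_singleton (x := x)) (Set.disjoint_singleton_right.mpr hx)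
  let F : C(X, ℂ) := ⟨fun z => (f z : ℂ), by fun_prop⟩
  have hF : ι F ∈ I := (hmem F).mpr fun z hz => by simpa [F] using hf0 hz
  rcases eq_bot_or_eq_top I with h | h
  · rw [h, TwoSidedIdeal.mem_bot] at hF
    have hFx : F x = 1 := by simpa [F] using hf1 rfl
    have hF0 : F = 0 := Finsupp.single_injective (0 : ℤ)
      (hfree.injective (by simp [skewSum_single, hF]))
    simp [hF0] at hFx
  · have h1 : ι 1 ∈ I := h ▸ trivial
    simpa using (hmem 1).mp h1 y hy

end SkewGroupAlgebra


/-- Let `X` be an infinite compact Hausdorff space, `T : X → X` a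
homeomorphism, and consider the induced action of `ℤ` on `X` where `n` acts as `T^n`.
The skew group algebra `C(X,ℂ) ⋊^σ ℤ` is modelled as a ring `R` with
`ι : C(X,ℂ) →+* R` and elements `u n`, `n : ℤ`, where the skew commutation relation
`u m * ι f = ι (f ∘ T^(-m)) * u m` is expressed via any continuous map `f'` agreeing
pointwise with `f ∘ T^(-m)`. Then `R` is simple if and only if the `ℤ`-action is
minimal, i.e. there is no nonempty proper closed subset `Y ⊆ X` with `T^n(Y) ⊆ Y`
for all `n : ℤ`. -/
theorem skew_group_algebra_int_simple_iff_minimal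
    {X : Type*} [TopologicalSpace X] [CompactSpace X] [T2Space X] [Infinite X]
    (T : X ≃ₜ X)
    {R : Type*} [Ring R] (ι : C(X, ℂ) →+* R) (u : ℤ → R)
    (hu_zero : u 0 = 1)
    (hu_add : ∀ m n : ℤ, u m * u n = u (m + n))
    (hu_comm : ∀ (m : ℤ) (f f' : C(X, ℂ)),
      (∀ x : X, f' x = f ((T.toEquiv ^ (-m)) x)) → u m * ι f = ι f' * u m)
    (hfree : Function.Bijective
      (fun a : ℤ →₀ C(X, ℂ) => a.sum fun n f => ι f * u n)) :
    IsSimpleRing R ↔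
      ¬ ∃ Y : Set X, Y.Nonempty ∧ Y ≠ Set.univ ∧ IsClosed Y ∧
        ∀ n : ℤ, (T.toEquiv ^ n) '' Y ⊆ Y := by
  have hcomm (m : ℤ) (f : C(X, ℂ)) : u m * ι f = ι (f.translate T m) * u m :=
    hu_comm m f _ fun _ => rfl
  exact ⟨fun _ => minimal_of_isSimpleRing hu_zero hu_add hcomm hfree,
    isSimpleRing_of_minimal hu_zero hu_add hcomm hfree⟩
end

section
/- Let X be a compact topological space and let M be a monoid acting on X such that for each m ∈ M the map x ↦ m·x is continuous. If the action of M on X is minimal, then the ring C(X,ℂ) is M-simple. -/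
open scoped ComplexOrder in
/-- An ideal of `C(X, 𝕜)`, with `X` compact, whose elements have no common zero is the whole
ring. No separation axiom on `X` is needed. -/
theorem ContinuousMap.ideal_eq_top_of_forall_exists_ne_zero_s4
    {X 𝕜 : Type*} [TopologicalSpace X] [CompactSpace X] [RCLike 𝕜] (I : Ideal C(X, 𝕜))
    (hI : ∀ x, ∃ f ∈ I, f x ≠ 0) : I = ⊤ := by
  obtain ⟨g, hgI, -, hg⟩ : ∃ g ∈ I, (∀ x, 0 ≤ g x) ∧ ∀ x ∈ Set.univ, g x ≠ 0 := by
    refine isCompact_univ.induction_on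
      (p := fun s => ∃ g ∈ I, (∀ x, 0 ≤ g x) ∧ ∀ x ∈ s, g x ≠ 0) ?_ ?_ ?_ ?_
    · exact ⟨0, I.zero_mem, fun _ => le_rfl, fun _ hx => hx.elim⟩
    · rintro s t hst ⟨g, hgI, hg0, hg⟩
      exact ⟨g, hgI, hg0, fun x hx => hg x (hst hx)⟩
    · rintro s t ⟨g, hgI, hg0, hg⟩ ⟨h, hhI, hh0, hh⟩
      refine ⟨g + h, I.add_mem hgI hhI, fun x => add_nonneg (hg0 x) (hh0 x), ?_⟩
      rintro x (hx | hx)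
      · exact (add_pos_of_pos_of_nonneg ((hg0 x).lt_of_ne' (hg x hx)) (hh0 x)).ne'
      · exact (add_pos_of_nonneg_of_pos (hg0 x) ((hh0 x).lt_of_ne' (hh x hx))).ne'
    · intro x _
      obtain ⟨f, hfI, hfx⟩ := hI x
      refine ⟨{y | f y ≠ 0}, mem_nhdsWithin_of_mem_nhds
        ((isOpen_ne_fun f.continuous continuous_const).mem_nhds hfx),
        star f * f, I.mul_mem_left _ hfI, fun y => star_mul_self_nonneg (f y), fun y hy => ?_⟩
      exact mul_ne_zero (star_ne_zero.2 hy) hy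
  exact I.eq_top_of_isUnit_mem hgI
    ((ContinuousMap.isUnit_iff_forall_ne_zero g).2 fun x => hg x (Set.mem_univ x))

/-- Let `X` be a compact space and let a monoid `M` act on `X` with
each map `x ↦ m • x` continuous. If the action of `M` on `X` is minimal, then the ring
`C(X,ℂ)` is `M`-simple: it has no nonzero proper ideal invariant under all the induced
ring endomorphisms `σ(m) : f ↦ f ∘ (m • ·)`. -/
theorem minimal_implies_M_simple
    {X : Type*} [TopologicalSpace X] [CompactSpace X]
    {M : Type*} [Monoid M] [MulAction M X]
    (hc : ∀ m : M, Continuous fun x : X => m • x)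
    (hmin : ¬ ∃ Y : Set X, Y.Nonempty ∧ Y ≠ Set.univ ∧ IsClosed Y ∧
      ∀ m : M, (fun x : X => m • x) '' Y ⊆ Y) :
    ∀ I : Ideal C(X, ℂ),
      (∀ m : M, ∀ f ∈ I, f.comp ⟨fun x : X => m • x, hc m⟩ ∈ I) →
      I = ⊥ ∨ I = ⊤ := by
  intro I hI
  by_cases hne : ∃ x, ∀ f ∈ I, f x = 0
  · left
    by_contra hbot
    refine hmin ⟨{x | ∀ f ∈ I, f x = 0}, hne, fun huniv => hbot ?_, ?_, ?_⟩
    · refine (Submodule.eq_bot_iff I).2 fun f hf => ContinuousMap.ext fun x => ?_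
      exact Set.eq_univ_iff_forall.1 huniv x f hf
    · simp only [Set.ofPred_forall]
      exact isClosed_biInter fun f _ => isClosed_eq f.continuous continuous_const
    · rintro m _ ⟨x, hx, rfl⟩ f hf
      exact hx _ (hI m f hf)
  · right
    push Not at hne
    exact ContinuousMap.ideal_eq_top_of_forall_exists_ne_zero_s4 I hne
end

section
/- Let X be a compact Hausdorff topological space and let M be a monoid acting on X such that for each m ∈ M the map x ↦ m·x is continuous. If the ring C(X,ℂ) is M-simple, then the action of M on X is minimal. -/
/-- Let `X` be a compact Hausdorff space and let a monoid `M` act on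
`X` with each map `x ↦ m • x` continuous. If the ring `C(X,ℂ)` is `M`-simple (no
nonzero proper ideal invariant under all `σ(m) : f ↦ f ∘ (m • ·)`), then the action of
`M` on `X` is minimal. -/
theorem M_simple_implies_minimal
    {X : Type*} [TopologicalSpace X] [CompactSpace X] [T2Space X]
    {M : Type*} [Monoid M] [MulAction M X]
    (hc : ∀ m : M, Continuous fun x : X => m • x)
    (hsimple : ∀ I : Ideal C(X, ℂ),
      (∀ m : M, ∀ f ∈ I, f.comp ⟨fun x : X => m • x, hc m⟩ ∈ I) →
      I = ⊥ ∨ I = ⊤) :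
    ¬ ∃ Y : Set X, Y.Nonempty ∧ Y ≠ Set.univ ∧ IsClosed Y ∧
      ∀ m : M, (fun x : X => m • x) '' Y ⊆ Y := by
  rintro ⟨Y, ⟨y, hy⟩, hne, hcl, hinv⟩
  have hI : ∀ m : M, ∀ f ∈ ContinuousMap.idealOfSet ℂ Yᶜ,
      f.comp ⟨fun x : X => m • x, hc m⟩ ∈ ContinuousMap.idealOfSet ℂ Yᶜ := by
    intro m f hf
    rw [ContinuousMap.mem_idealOfSet, compl_compl] at hf ⊢
    intro x hx
    exact hf (hinv m ⟨x, hx, rfl⟩)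
  rcases hsimple _ hI with h | h
  · refine hne (Set.compl_empty_iff.mp ?_)
    rw [← ContinuousMap.setOfIdeal_ofSet_of_isOpen ℂ hcl.isOpen_compl, h]
    ext x
    simp [ContinuousMap.mem_setOfIdeal]
  · have h1 : (1 : C(X, ℂ)) ∈ ContinuousMap.idealOfSet ℂ Yᶜ := h ▸ Submodule.mem_top
    rw [ContinuousMap.mem_idealOfSet] at h1
    exact one_ne_zero (h1 (by simpa using hy))
end

section
/- Let G be a group acting on a commutative unital ring A by ring automorphisms via σ : G → Aut(A). Then every nonzero two-sided ideal I of the skew group algebra A ⋊^σ G has nonzero intersection with the subring A u_e if and only if A u_e is maximal commutative in A ⋊^σ G. -/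
section SkewGroupRing

variable {A : Type*} [CommRing A] {G : Type*} {R : Type*} [Ring R] {ι : A →+* R} {u : G → R}

/-- Elements of a skew group ring correspond to their coefficient functions. -/
theorem exists_coeff_addEquiv
    (hfree : Function.Bijective (fun x : G →₀ A => x.sum fun g a => ι a * u g)) :
    ∃ c : R ≃+ (G →₀ A), ∀ g a, c (ι a * u g) = Finsupp.single g a := by
  let Φ : (G →₀ A) →+ R :=
    Finsupp.liftAddHom fun g => (AddMonoidHom.mulRight (u g)).comp ι.toAddMonoidHom
  have hΦ : Function.Bijective Φ := hfree
  refine ⟨(AddEquiv.ofBijective Φ hΦ).symm, fun g a => ?_⟩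
  rw [AddEquiv.symm_apply_eq]
  simp [Φ]

theorem skew_induction {c : R ≃+ (G →₀ A)}
    (hc : ∀ g a, c (ι a * u g) = Finsupp.single g a) {p : R → Prop} (x : R)
    (h_zero : p 0) (h_add : ∀ x y, p x → p y → p (x + y))
    (h_monomial : ∀ a g, p (ι a * u g)) : p x := by
  have key : ∀ f : G →₀ A, p (c.symm f) := by
    intro f
    induction f using Finsupp.induction_linear with
    | zero => simpa using h_zero
    | add f g hf hg => rw [map_add]; exact h_add _ _ hf hg
    | single g a => rw [← hc g a, AddEquiv.symm_apply_apply]; exact h_monomial a g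
  simpa using key (c x)

theorem coeff_map_mul {c : R ≃+ (G →₀ A)}
    (hc : ∀ g a, c (ι a * u g) = Finsupp.single g a)
    (x : R) (a : A) (g : G) : c (ι a * x) g = a * c x g := by
  induction x using skew_induction hc with
  | h_zero => simp
  | h_add x y hx hy => simp [mul_add, hx, hy]
  | h_monomial b h =>
    rw [← mul_assoc, ← map_mul, hc, hc]
    obtain rfl | hne := eq_or_ne h g
    · simp
    · simp [Finsupp.single_eq_of_ne' hne]

variable [Group G] {σ : G →* RingAut A}

theorem monomial_mul_monomial (hu_mul : ∀ g h : G, u g * u h = u (g * h))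
    (hu_comm : ∀ (g : G) (a : A), u g * ι a = ι (σ g a) * u g) (a b : A) (g h : G) :
    ι a * u g * (ι b * u h) = ι (a * σ g b) * u (g * h) := by
  rw [mul_assoc, ← mul_assoc (u g), hu_comm, mul_assoc, hu_mul, ← mul_assoc, map_mul]

theorem coeff_mul_map (hu_comm : ∀ (g : G) (a : A), u g * ι a = ι (σ g a) * u g)
    {c : R ≃+ (G →₀ A)} (hc : ∀ g a, c (ι a * u g) = Finsupp.single g a)
    (x : R) (a : A) (g : G) : c (x * ι a) g = c x g * σ g a := by
  induction x using skew_induction hc with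
  | h_zero => simp
  | h_add x y hx hy => simp [add_mul, hx, hy]
  | h_monomial b h =>
    rw [mul_assoc, hu_comm, ← mul_assoc, ← map_mul, hc, hc]
    obtain rfl | hne := eq_or_ne h g
    · simp
    · simp [Finsupp.single_eq_of_ne' hne]

theorem coeff_mul_unit (hu_mul : ∀ g h : G, u g * u h = u (g * h))
    {c : R ≃+ (G →₀ A)} (hc : ∀ g a, c (ι a * u g) = Finsupp.single g a)
    (x : R) (g h : G) : c (x * u h) g = c x (g * h⁻¹) := by
  induction x using skew_induction hc with
  | h_zero => simp
  | h_add x y hx hy => simp [add_mul, hx, hy]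
  | h_monomial b k =>
    rw [mul_assoc, hu_mul, hc, hc]
    classical
    simp [Finsupp.single_apply, eq_mul_inv_iff_mul_eq]

/-- If the coefficient ring is maximal commutative, it meets every nonzero ideal: an element of
minimal support, shifted so that its coefficient at `1` is nonzero, commutes with `A`. -/
theorem exists_mem_range_of_centralizer_subset
    (hu_mul : ∀ g h : G, u g * u h = u (g * h))
    (hu_comm : ∀ (g : G) (a : A), u g * ι a = ι (σ g a) * u g)
    {c : R ≃+ (G →₀ A)} (hc : ∀ g a, c (ι a * u g) = Finsupp.single g a)
    (hmax : ∀ r : R, (∀ a : A, r * ι a = ι a * r) → r ∈ Set.range ι)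
    (I : TwoSidedIdeal R) {x : R} (hx : x ∈ I) (hx0 : x ≠ 0) :
    ∃ r : R, r ≠ 0 ∧ r ∈ I ∧ r ∈ Set.range ι := by
  classical
  induction hn : (c x).support.card using Nat.strong_induction_on generalizing x with
  | h n ih =>
    have hcx : c x ≠ 0 := by simpa using hx0
    obtain ⟨g, hg⟩ := Finsupp.ne_iff.mp hcx
    have hy1 : c (x * u g⁻¹) 1 ≠ 0 := by simpa [coeff_mul_unit hu_mul hc] using hg
    have hyI : x * u g⁻¹ ∈ I := I.mul_mem_right _ _ hx
    have hcard : (c (x * u g⁻¹)).support.card ≤ n := by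
      rw [← hn]
      refine Finset.card_le_card_of_injOn (· * g) (fun k hk => ?_)
        (mul_left_injective g).injOn
      simpa [coeff_mul_unit hu_mul hc] using hk
    generalize x * u g⁻¹ = y at hy1 hyI hcard
    by_cases hcomm : ∀ a : A, y * ι a = ι a * y
    · refine ⟨y, ?_, hyI, hmax y hcomm⟩
      rintro rfl
      simp at hy1
    · obtain ⟨a, ha⟩ := not_forall.mp hcomm
      refine ih _ (lt_of_lt_of_le (Finset.card_lt_card ?_) hcard)
        (I.sub_mem (I.mul_mem_right _ (ι a) hyI) (I.mul_mem_left (ι a) _ hyI))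
        (sub_ne_zero.mpr ha) rfl
      have hcoeff : ∀ k, c (y * ι a - ι a * y) k = c y k * σ k a - a * c y k := fun k => by
        rw [map_sub, Finsupp.sub_apply, coeff_mul_map hu_comm hc, coeff_map_mul hc]
      refine (Finset.ssubset_iff_of_subset fun k hk => ?_).mpr ⟨1, ?_, ?_⟩
      · rw [Finsupp.mem_support_iff, hcoeff] at hk
        rw [Finsupp.mem_support_iff]
        intro h
        simp [h] at hk
      · simpa using hy1
      · rw [Finsupp.mem_support_iff, hcoeff, not_not, map_one σ, RingAut.one_apply, mul_comm,
          sub_self]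

/-- The largest two-sided ideal contained in the kernel of an additive map. -/
def TwoSidedIdeal.coreKer {R M : Type*} [Ring R] [AddCommGroup M] (ε : R →+ M) :
    TwoSidedIdeal R :=
  TwoSidedIdeal.mk' {x | ∀ y z, ε (y * x * z) = 0}
    (by simp)
    (by intro x x' hx hx' y z; simp [mul_add, add_mul, hx y z, hx' y z])
    (by intro x hx y z; simp [hx y z])
    (by intro w x hx y z; simpa [mul_assoc] using hx (y * w) z)
    (by intro x w hx y z; simpa [mul_assoc] using hx y (w * z))

theorem TwoSidedIdeal.mem_coreKer {R M : Type*} [Ring R] [AddCommGroup M] {ε : R →+ M} {x : R} :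
    x ∈ TwoSidedIdeal.coreKer ε ↔ ∀ y z, ε (y * x * z) = 0 := by
  unfold TwoSidedIdeal.coreKer
  rw [TwoSidedIdeal.mem_mk']
  rfl

/-- If `b` is nonzero and `b * σ g a = b * a` for all `a`, with `g ≠ 1`, then some nonzero ideal
containing `b (1 - u g)` meets the coefficient ring trivially: all its elements have
coefficient sum zero. -/
theorem exists_ideal_disjoint_range
    (hu_mul : ∀ g h : G, u g * u h = u (g * h))
    (hu_comm : ∀ (g : G) (a : A), u g * ι a = ι (σ g a) * u g)
    {c : R ≃+ (G →₀ A)} (hc : ∀ g a, c (ι a * u g) = Finsupp.single g a)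
    {g : G} (hg : g ≠ 1) {b : A} (hb : b ≠ 0) (hfix : ∀ a, b * σ g a = b * a) :
    ∃ I : TwoSidedIdeal R, I ≠ ⊥ ∧ ∀ r ∈ I, r ∈ Set.range ι → r = 0 := by
  let ε : R →+ A := (Finsupp.liftAddHom fun _ => AddMonoidHom.id A).comp c.toAddMonoidHom
  have hε : ∀ a h, ε (ι a * u h) = a := fun a h => by simp [ε, hc]
  refine ⟨TwoSidedIdeal.coreKer ε, fun hbot => ?_, ?_⟩
  · have hmem : ι b * u 1 - ι b * u g ∈ TwoSidedIdeal.coreKer ε := by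
      rw [TwoSidedIdeal.mem_coreKer]
      intro y z
      induction y using skew_induction hc with
      | h_zero => simp
      | h_add y y' hy hy' => rw [add_mul, add_mul, map_add, hy, hy', add_zero]
      | h_monomial a s =>
        induction z using skew_induction hc with
        | h_zero => simp
        | h_add z z' hz hz' => rw [mul_add, map_add, hz, hz', add_zero]
        | h_monomial d t =>
          rw [mul_assoc, sub_mul, mul_sub, map_sub]
          simp only [monomial_mul_monomial hu_mul hu_comm, hε, hfix, map_one, RingAut.one_apply,
            sub_self]
    rw [hbot, TwoSidedIdeal.mem_bot] at hmem
    have h1 : c (ι b * u 1 - ι b * u g) 1 = 0 := by rw [hmem]; simp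
    rw [map_sub, hc, hc, Finsupp.sub_apply, Finsupp.single_eq_same,
      Finsupp.single_eq_of_ne' hg, sub_zero] at h1
    exact hb h1
  · rintro _ hr ⟨a, rfl⟩
    have h := TwoSidedIdeal.mem_coreKer.mp hr 1 (u 1)
    rw [one_mul, hε] at h
    rw [h, map_zero]

end SkewGroupRing

/-- Let a group `G` act on a commutative unital ring `A` by ring
automorphisms via `σ : G →* RingAut A`. In the skew group algebra `A ⋊^σ G`
(modelled as a ring `R` with `ι : A →+* R`, elements `u g`, the skew commutation
relation and freeness), every nonzero two-sided ideal has nonzero intersection with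
the subring `A u_e = range ι` if and only if `A u_e` is maximal commutative in `R`. -/
theorem ideal_intersection_iff_maximal_commutative
    {A : Type*} [CommRing A] {G : Type*} [Group G] (σ : G →* RingAut A)
    {R : Type*} [Ring R] (ι : A →+* R) (u : G → R)
    (hu_one : u 1 = 1)
    (hu_mul : ∀ g h : G, u g * u h = u (g * h))
    (hu_comm : ∀ (g : G) (a : A), u g * ι a = ι (σ g a) * u g)
    (hfree : Function.Bijective
      (fun x : G →₀ A => x.sum fun g a => ι a * u g)) :
    (∀ I : TwoSidedIdeal R, I ≠ ⊥ → ∃ r : R, r ≠ 0 ∧ r ∈ I ∧ r ∈ Set.range ι) ↔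
      {r : R | ∀ a : A, r * ι a = ι a * r} = Set.range ι := by
  obtain ⟨c, hc⟩ := exists_coeff_addEquiv hfree
  constructor
  · intro H
    refine Set.Subset.antisymm (fun r hr => ?_) ?_
    · by_contra hrange
      obtain ⟨g, hg, hb⟩ : ∃ g, g ≠ 1 ∧ c r g ≠ 0 := by
        by_contra! h
        refine hrange ⟨c r 1, ?_⟩
        rw [← mul_one (ι _), ← hu_one]
        apply c.injective
        rw [hc]
        ext k
        obtain rfl | hk := eq_or_ne k 1
        · simp
        · rw [h k hk, Finsupp.single_eq_of_ne hk]
      have hfix : ∀ a, c r g * σ g a = c r g * a := fun a => by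
        rw [← coeff_mul_map hu_comm hc, hr a, coeff_map_mul hc, mul_comm]
      obtain ⟨I, hI, hdisj⟩ :=
        exists_ideal_disjoint_range hu_mul hu_comm hc hg hb hfix
      obtain ⟨x, hx0, hxI, hx⟩ := H I hI
      exact hx0 (hdisj x hxI hx)
    · rintro _ ⟨b, rfl⟩ a
      rw [← map_mul, ← map_mul, mul_comm]
  · intro H I hI
    obtain ⟨x, hx, hx0⟩ : ∃ x ∈ I, x ≠ 0 := by
      by_contra! h
      exact hI (eq_bot_iff.mpr fun x hx => (TwoSidedIdeal.mem_bot R).mpr (h x hx))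
    exact exists_mem_range_of_centralizer_subset hu_mul hu_comm hc (fun r hr => H.subset hr) I hx hx0
end

section
/- Let G be a group acting on a unital ring A by ring automorphisms via σ : G → Aut(A). If the skew group algebra A ⋊^σ G is a simple ring, then: (1) A is G-simple; (2) the center Z(A ⋊^σ G) is a field; and (3) σ has trivial kernel, i.e. σ(g) = id_A implies g = e. -/
section SkewGroupAlgebra

variable {A : Type*} [Ring A] {G : Type*} [Group G] {σ : G →* RingAut A}
  {R : Type*} [Ring R] {ι : A →+* R} {u : G → R}

/-- The universal property of a skew group algebra: a covariant pair `(f, v)` with values in a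
ring `S` extends to a ring homomorphism. -/
theorem exists_ringHom_of_covariant {S : Type*} [Ring S]
    (hu_one : u 1 = 1) (hu_mul : ∀ g h : G, u g * u h = u (g * h))
    (hu_comm : ∀ (g : G) (a : A), u g * ι a = ι (σ g a) * u g)
    (hfree : Function.Bijective (fun x : G →₀ A => x.sum fun g a => ι a * u g))
    (f : A →+* S) (v : G →* S) (hv : ∀ (g : G) (a : A), v g * f a = f (σ g a) * v g) :
    ∃ F : R →+* S, (∀ a, F (ι a) = f a) ∧ ∀ g, F (u g) = v g := by
  let e : (G →₀ A) ≃+ R := AddEquiv.ofBijective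
    (Finsupp.liftAddHom fun g => (AddMonoidHom.mulRight (u g)).comp ι.toAddMonoidHom) hfree
  have he (g : G) (a : A) : e (Finsupp.single g a) = ι a * u g := by
    simp [e]
  let Φ : R →+ S := (Finsupp.liftAddHom fun g =>
    (AddMonoidHom.mulRight (v g)).comp f.toAddMonoidHom).comp e.symm.toAddMonoidHom
  have hΦ (g : G) (a : A) : Φ (ι a * u g) = f a * v g := by
    rw [← he]
    simp [Φ]
  have hΦ_one : Φ 1 = 1 := by
    simpa [hu_one] using hΦ 1 1
  have hΦ_mul (x y : R) : Φ (x * y) = Φ x * Φ y := by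
    obtain ⟨p, rfl⟩ := e.surjective x
    obtain ⟨q, rfl⟩ := e.surjective y
    induction p using Finsupp.induction_linear with
    | zero => simp
    | add p₁ p₂ h₁ h₂ => simp only [map_add, add_mul, h₁, h₂]
    | single g a =>
      induction q using Finsupp.induction_linear with
      | zero => simp
      | add q₁ q₂ h₁ h₂ => simp only [map_add, mul_add, h₁, h₂]
      | single h b =>
        have hmul : ι a * u g * (ι b * u h) = ι (a * σ g b) * u (g * h) := by
          rw [map_mul, ← hu_mul, mul_assoc, ← mul_assoc (u g), hu_comm]
          simp only [mul_assoc]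
        rw [he, he, hmul, hΦ, hΦ, hΦ, map_mul, map_mul, mul_assoc (f a) (v g),
          ← mul_assoc (v g), hv]
        simp only [mul_assoc]
  refine ⟨{ Φ with map_one' := hΦ_one, map_mul' := hΦ_mul }, fun a => ?_, fun g => ?_⟩
  · simpa [hu_one] using hΦ 1 a
  · simpa using hΦ g 1

/-- If the skew group algebra is simple, then it acts faithfully on every nontrivial ring `B`
that receives an equivariant ring homomorphism from `A`. -/
theorem exists_injective_ringHom_end [IsSimpleRing R]
    (hu_one : u 1 = 1) (hu_mul : ∀ g h : G, u g * u h = u (g * h))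
    (hu_comm : ∀ (g : G) (a : A), u g * ι a = ι (σ g a) * u g)
    (hfree : Function.Bijective (fun x : G →₀ A => x.sum fun g a => ι a * u g))
    {B : Type*} [Ring B] [Nontrivial B] (q : A →+* B) (τ : G → B →+* B)
    (hτ_one : τ 1 = RingHom.id B) (hτ_mul : ∀ g h, τ (g * h) = (τ g).comp (τ h))
    (hτ : ∀ g a, τ g (q a) = q (σ g a)) :
    ∃ F : R →+* AddMonoid.End B, Function.Injective F ∧
      (∀ a b, F (ι a) b = q a * b) ∧ ∀ g b, F (u g) b = τ g b := by
  let v : G →* AddMonoid.End B :=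
    { toFun := fun g => (τ g).toAddMonoidHom
      map_one' := AddMonoidHom.ext fun b => congrArg (· b) hτ_one
      map_mul' := fun g h => AddMonoidHom.ext fun b => congrArg (· b) (hτ_mul g h) }
  obtain ⟨F, hFι, hFu⟩ := exists_ringHom_of_covariant hu_one hu_mul hu_comm hfree
    ((Module.toAddMonoidEnd B B).comp q) v (fun g a => AddMonoidHom.ext fun b => by
      change τ g (q a * b) = q (σ g a) * τ g b
      rw [map_mul, hτ])
  have : Nontrivial (AddMonoid.End B) :=
    ⟨1, 0, fun h => one_ne_zero (α := B) (DFunLike.congr_fun h (1 : B))⟩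
  refine ⟨F, F.injective, fun a b => ?_, fun g b => ?_⟩
  · rw [hFι]
    rfl
  · rw [hFu]
    rfl

end SkewGroupAlgebra


/-- Let a group `G` act on a unital ring `A` by ring automorphisms
via `σ : G →* RingAut A`. If the skew group algebra `A ⋊^σ G` (modelled as a ring `R`
with `ι : A →+* R`, elements `u g`, the skew commutation relation and freeness) is a
simple ring, then: (1) `A` is `G`-simple; (2) the center `Z(A ⋊^σ G)` is a field; and
(3) `σ` has trivial kernel. -/
theorem skew_group_algebra_simple_implies
    {A : Type*} [Ring A] {G : Type*} [Group G] (σ : G →* RingAut A)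
    {R : Type*} [Ring R] (ι : A →+* R) (u : G → R)
    (hu_one : u 1 = 1)
    (hu_mul : ∀ g h : G, u g * u h = u (g * h))
    (hu_comm : ∀ (g : G) (a : A), u g * ι a = ι (σ g a) * u g)
    (hfree : Function.Bijective
      (fun x : G →₀ A => x.sum fun g a => ι a * u g))
    (hsimple : IsSimpleRing R) :
    (∀ I : TwoSidedIdeal A, (∀ (g : G) (a : A), a ∈ I → σ g a ∈ I) → I = ⊥ ∨ I = ⊤) ∧
    IsField (Subring.center R) ∧
    (∀ g : G, (∀ a : A, σ g a = a) → g = 1) := by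
  have hA : Nontrivial A := by
    by_contra h
    rw [not_nontrivial_iff_subsingleton] at h
    exact one_ne_zero (α := R) (by simpa using congrArg ι (Subsingleton.elim (1 : A) 0))
  refine ⟨fun I hI => ?_, IsSimpleRing.isField_center R, fun g hg => ?_⟩
  · rw [or_iff_not_imp_right]
    intro hI_top
    have hmem {a b : A} : I.ringCon a b ↔ a - b ∈ I := TwoSidedIdeal.rel_iff I a b
    have hB : Nontrivial I.ringCon.Quotient := by
      refine ⟨1, 0, fun h => hI_top (I.one_mem_iff.1 ?_)⟩
      exact (TwoSidedIdeal.mem_iff I 1).2 ((RingCon.eq I.ringCon).1 h)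
    let τ (g : G) : I.ringCon.Quotient →+* I.ringCon.Quotient :=
      I.ringCon.lift (I.ringCon.mk'.comp (σ g : A →+* A)) fun a b hab =>
        (RingCon.eq I.ringCon).2 <| hmem.2 <| by
          simpa using hI g _ (hmem.1 hab)
    have hτ (g : G) (a : A) : τ g (I.ringCon.mk' a) = I.ringCon.mk' (σ g a) := rfl
    obtain ⟨F, hF, hFι, -⟩ := exists_injective_ringHom_end hu_one hu_mul hu_comm hfree
      I.ringCon.mk' τ
      (RingHom.ext <| I.ringCon.mk'_surjective.forall.2 fun a => by rw [hτ]; simp)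
      (fun g h => RingHom.ext <| I.ringCon.mk'_surjective.forall.2 fun a => by
        rw [RingHom.comp_apply, hτ, hτ, hτ]; simp)
      hτ
    refine le_bot_iff.1 fun a ha => (TwoSidedIdeal.mem_bot A).2 ?_
    have hqa : I.ringCon.mk' a = 0 := (RingCon.eq I.ringCon).2 ((TwoSidedIdeal.mem_iff I a).1 ha)
    have hιa : ι a = 0 := hF <| by
      rw [map_zero]
      ext b
      rw [hFι, hqa, zero_mul]
      rfl
    have : Finsupp.single (1 : G) a = 0 := hfree.injective <| by simp [hιa]
    simpa using this
  · obtain ⟨F, hF, -, hFu⟩ := exists_injective_ringHom_end hu_one hu_mul hu_comm hfree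
      (RingHom.id A) (fun g => (σ g : A →+* A)) (by ext; simp) (fun g h => by ext; simp)
      (fun _ _ => rfl)
    have hug : u g = u 1 := hF <| by
      ext b
      simp [hFu, hg]
    have : Finsupp.single g (1 : A) = Finsupp.single 1 1 := hfree.injective <| by
      simp [hug]
    exact Finsupp.single_left_injective one_ne_zero this
end

section
/- Let G be an abelian group acting on a unital ring A by ring automorphisms via σ : G → Aut(A). Then the skew group algebra A ⋊^σ G is a simple ring if and only if all of the following hold: (1) A is G-simple; (2) the center Z(A ⋊^σ G) is a field; and (3) σ has trivial kernel, i.e. σ(g) = id_A implies g = e. -/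
/-- `c` is the coefficient map of a skew group algebra `R = A ⋊^σ G` with coefficient embedding `ι`
and group basis `u`. -/
structure IsSkewCoeff {A : Type*} [Ring A] {G : Type*} [Group G] (σ : G →* RingAut A)
    {R : Type*} [Ring R] (ι : A →+* R) (u : G → R) (c : R ≃+ (G →₀ A)) : Prop where
  one : u 1 = 1
  mul : ∀ g h : G, u g * u h = u (g * h)
  comm : ∀ (g : G) (a : A), u g * ι a = ι (σ g a) * u g
  coeff : ∀ (a : A) (g : G), c (ι a * u g) = Finsupp.single g a

namespace IsSkewCoeff

theorem nontrivial_of_addEquiv {A G R : Type*} [Ring A] [Ring R] (c : R ≃+ (G →₀ A))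
    [Nontrivial R] : Nontrivial A := by
  by_contra hA
  rw [not_nontrivial_iff_subsingleton] at hA
  exact one_ne_zero (c.injective (Subsingleton.elim (c 1) (c 0)))

section Group

variable {A : Type*} [Ring A] {G : Type*} [Group G] {σ : G →* RingAut A}
  {R : Type*} [Ring R] {ι : A →+* R} {u : G → R} {c : R ≃+ (G →₀ A)}

theorem induction (H : IsSkewCoeff σ ι u c) {p : R → Prop} (zero : p 0)
    (add : ∀ x y, p x → p y → p (x + y)) (basis : ∀ a g, p (ι a * u g)) (r : R) : p r := by
  rw [← c.symm_apply_apply r]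
  induction c r using Finsupp.induction_linear with
  | zero => simpa using zero
  | add x y hx hy => simpa using add _ _ hx hy
  | single g a =>
    rw [← H.coeff, c.symm_apply_apply]
    exact basis a g

theorem coeff_ι_mul (H : IsSkewCoeff σ ι u c) (a : A) (r : R) (g : G) :
    c (ι a * r) g = a * c r g := by
  classical
  induction r using H.induction with
  | zero => simp
  | add x y hx hy => simp [mul_add, hx, hy]
  | basis b h =>
    rw [← mul_assoc, ← map_mul, H.coeff, H.coeff, Finsupp.single_apply, Finsupp.single_apply]
    split_ifs <;> simp

theorem coeff_mul_ι (H : IsSkewCoeff σ ι u c) (r : R) (a : A) (g : G) :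
    c (r * ι a) g = c r g * σ g a := by
  classical
  induction r using H.induction with
  | zero => simp
  | add x y hx hy => simp [add_mul, hx, hy]
  | basis b h =>
    rw [mul_assoc, H.comm, ← mul_assoc, ← map_mul, H.coeff, H.coeff, Finsupp.single_apply,
      Finsupp.single_apply]
    split_ifs with hg <;> simp [hg]

theorem coeff_mul_u (H : IsSkewCoeff σ ι u c) (r : R) (h g : G) :
    c (r * u h) g = c r (g * h⁻¹) := by
  classical
  induction r using H.induction with
  | zero => simp
  | add x y hx hy => simp [add_mul, hx, hy]
  | basis b k =>
    rw [mul_assoc, H.mul, H.coeff, H.coeff, Finsupp.single_apply, Finsupp.single_apply]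
    simp only [eq_mul_inv_iff_mul_eq]

theorem coeff_u_mul (H : IsSkewCoeff σ ι u c) (h : G) (r : R) (g : G) :
    c (u h * r) g = σ h (c r (h⁻¹ * g)) := by
  classical
  induction r using H.induction with
  | zero => simp
  | add x y hx hy => simp [mul_add, hx, hy]
  | basis b k =>
    rw [← mul_assoc, H.comm, mul_assoc, H.mul, H.coeff, H.coeff, Finsupp.single_apply,
      Finsupp.single_apply]
    simp only [eq_inv_mul_iff_mul_eq]
    split_ifs <;> simp

theorem coeff_ι (H : IsSkewCoeff σ ι u c) (a : A) : c (ι a) = Finsupp.single 1 a := by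
  simpa [H.one] using H.coeff a 1

theorem coeff_one (H : IsSkewCoeff σ ι u c) : c 1 = Finsupp.single 1 1 := by
  simpa using H.coeff_ι 1

theorem coeff_u (H : IsSkewCoeff σ ι u c) (g : G) : c (u g) = Finsupp.single g 1 := by
  simpa using H.coeff 1 g

theorem mul_u_cancel (H : IsSkewCoeff σ ι u c) (r : R) (g : G) : r * u g * u g⁻¹ = r := by
  rw [mul_assoc, H.mul, mul_inv_cancel, H.one, mul_one]

theorem mul_u_inv_cancel (H : IsSkewCoeff σ ι u c) (r : R) (g : G) : r * u g⁻¹ * u g = r := by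
  rw [mul_assoc, H.mul, inv_mul_cancel, H.one, mul_one]

/-- An element commuting with the coefficients and the group basis is central. -/
theorem mem_center (H : IsSkewCoeff σ ι u c) {z : R} (hι : ∀ a, z * ι a = ι a * z)
    (hu : ∀ g, z * u g = u g * z) : z ∈ Subring.center R := by
  rw [Subring.mem_center_iff]
  intro r
  induction r using H.induction with
  | zero => simp
  | add x y hx hy => rw [add_mul, mul_add, hx, hy]
  | basis a g => rw [mul_assoc, ← hu, ← mul_assoc, ← hι, mul_assoc]

/-- The ideal of elements of a skew group algebra with all coefficients in a given invariant
ideal of the coefficient ring. -/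
def extend (H : IsSkewCoeff σ ι u c) (I : TwoSidedIdeal A)
    (hI : ∀ (g : G) (a : A), a ∈ I → σ g a ∈ I) : TwoSidedIdeal R :=
  .mk' {r | ∀ g, c r g ∈ I}
    (by simp [I.zero_mem])
    (fun hx hy g => by simpa using I.add_mem (hx g) (hy g))
    (fun hx g => by simpa using I.neg_mem (hx g))
    (by
      intro r y hy
      induction r using H.induction with
      | zero => simp [I.zero_mem]
      | add r s hr hs => intro g; simpa [add_mul] using I.add_mem (hr g) (hs g)
      | basis a h =>
        intro g
        rw [mul_assoc, H.coeff_ι_mul, H.coeff_u_mul]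
        exact I.mul_mem_left _ _ (hI _ _ (hy _)))
    (by
      intro y r hy
      induction r using H.induction with
      | zero => simp [I.zero_mem]
      | add r s hr hs => intro g; simpa [mul_add] using I.add_mem (hr g) (hs g)
      | basis a h =>
        intro g
        rw [← mul_assoc, H.coeff_mul_u, H.coeff_mul_ι]
        exact I.mul_mem_right _ _ (hy _))

theorem mem_extend (H : IsSkewCoeff σ ι u c) (I : TwoSidedIdeal A)
    (hI : ∀ (g : G) (a : A), a ∈ I → σ g a ∈ I) (r : R) :
    r ∈ H.extend I hI ↔ ∀ g, c r g ∈ I := by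
  rw [extend, TwoSidedIdeal.mem_mk']
  rfl

theorem eq_bot_or_eq_top_of_isSimpleRing (H : IsSkewCoeff σ ι u c) [IsSimpleRing R]
    (I : TwoSidedIdeal A) (hI : ∀ (g : G) (a : A), a ∈ I → σ g a ∈ I) : I = ⊥ ∨ I = ⊤ := by
  classical
  refine (eq_bot_or_eq_top (H.extend I hI)).imp (fun h => ?_) (fun h => ?_)
  · refine eq_bot_iff.2 fun a ha => ?_
    have hmem : ι a ∈ H.extend I hI := by
      rw [mem_extend]
      intro g
      rw [H.coeff_ι, Finsupp.single_apply]
      split_ifs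
      · exact ha
      · exact I.zero_mem
    rw [h, TwoSidedIdeal.mem_bot] at hmem
    have ha0 := H.coeff_ι a
    rw [hmem, map_zero, eq_comm, Finsupp.single_eq_zero] at ha0
    rw [TwoSidedIdeal.mem_bot, ha0]
  · have hmem : (1 : R) ∈ H.extend I hI := h ▸ TwoSidedIdeal.mem_top _
    rw [mem_extend] at hmem
    have h1 := hmem 1
    rw [H.coeff_one, Finsupp.single_eq_same] at h1
    exact I.one_mem_iff.1 h1

theorem sum_coeff_mul_u (H : IsSkewCoeff σ ι u c) (r : R) (g : G) :
    ((c (r * u g)).sum fun _ a => a) = (c r).sum fun _ a => a := by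
  induction r using H.induction with
  | zero => simp
  | add x y hx hy =>
    rw [add_mul, map_add, map_add, Finsupp.sum_add_index' (by simp) (by simp),
      Finsupp.sum_add_index' (by simp) (by simp), hx, hy]
  | basis a h => simp [mul_assoc, H.mul, H.coeff]

/-- A nonzero ideal contains a nonzero element supported at `1` whose support is minimal. -/
theorem exists_minimal_support (H : IsSkewCoeff σ ι u c) {J : TwoSidedIdeal R} (hJ : J ≠ ⊥) :
    ∃ x ∈ J, c x 1 ≠ 0 ∧
      ∀ w ∈ J, (∀ g, c x g = 0 → c w g = 0) → c w 1 = 0 → w = 0 := by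
  have hne : {S : Finset G | ∃ x ∈ J, x ≠ 0 ∧ (c x).support = S}.Nonempty := by
    by_contra h
    refine hJ (eq_bot_iff.2 fun x hx => ?_)
    rw [TwoSidedIdeal.mem_bot]
    by_contra hx0
    exact h ⟨_, x, hx, hx0, rfl⟩
  obtain ⟨_, ⟨x, hx, hx0, rfl⟩, hmin⟩ := wellFounded_lt.has_min _ hne
  obtain ⟨k, hk⟩ : ∃ k, c x k ≠ 0 := by
    by_contra! h
    exact hx0 (c.map_eq_zero_iff.1 (Finsupp.ext h))
  refine ⟨x * u k⁻¹, J.mul_mem_right _ _ hx, by simpa [H.coeff_mul_u] using hk,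
    fun w hw hsupp hw1 => ?_⟩
  by_contra hw0
  refine hmin _ ⟨w * u k, J.mul_mem_right _ _ hw, fun h => hw0 ?_, rfl⟩ ?_
  · rw [← H.mul_u_cancel w k, h, zero_mul]
  · refine Finset.ssubset_iff_subset_ne.2 ⟨fun g hg => ?_, fun h => ?_⟩
    · rw [Finsupp.mem_support_iff] at hg ⊢
      refine fun hxg => hg ?_
      rw [H.coeff_mul_u]
      apply hsupp
      simpa [H.coeff_mul_u] using hxg
    · have hk' : k ∈ (c (w * u k)).support := h ▸ Finsupp.mem_support_iff.2 hk
      rw [Finsupp.mem_support_iff, H.coeff_mul_u, mul_inv_cancel] at hk'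
      exact hk' hw1

end Group

section CommGroup

variable {A : Type*} [Ring A] {G : Type*} [CommGroup G] {σ : G →* RingAut A}
  {R : Type*} [Ring R] {ι : A →+* R} {u : G → R} {c : R ≃+ (G →₀ A)}

theorem coeff_conj (H : IsSkewCoeff σ ι u c) (h : G) (r : R) (g : G) :
    c (u h * r * u h⁻¹) g = σ h (c r g) := by
  rw [H.coeff_mul_u, H.coeff_u_mul, inv_inv, mul_comm g h, inv_mul_cancel_left]

/-- The ideal of coefficients at `1` of the elements of `J` supported in `S`. -/
def leading (H : IsSkewCoeff σ ι u c) (J : TwoSidedIdeal R) (S : Set G) : TwoSidedIdeal A :=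
  .mk' {a | ∃ y ∈ J, (∀ g ∉ S, c y g = 0) ∧ c y 1 = a}
    ⟨0, J.zero_mem, by simp, by simp⟩
    (by
      rintro _ _ ⟨y, hy, hyS, rfl⟩ ⟨z, hz, hzS, rfl⟩
      exact ⟨y + z, J.add_mem hy hz, fun g hg => by simp [hyS g hg, hzS g hg], by simp⟩)
    (by
      rintro _ ⟨y, hy, hyS, rfl⟩
      exact ⟨-y, J.neg_mem hy, fun g hg => by simp [hyS g hg], by simp⟩)
    (by
      rintro b _ ⟨y, hy, hyS, rfl⟩
      exact ⟨ι b * y, J.mul_mem_left _ _ hy, fun g hg => by simp [H.coeff_ι_mul, hyS g hg],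
        by simp [H.coeff_ι_mul]⟩)
    (by
      rintro _ b ⟨y, hy, hyS, rfl⟩
      exact ⟨y * ι b, J.mul_mem_right _ _ hy, fun g hg => by simp [H.coeff_mul_ι, hyS g hg],
        by simp [H.coeff_mul_ι]⟩)

theorem mem_leading (H : IsSkewCoeff σ ι u c) (J : TwoSidedIdeal R) (S : Set G) (a : A) :
    a ∈ H.leading J S ↔ ∃ y ∈ J, (∀ g ∉ S, c y g = 0) ∧ c y 1 = a := by
  rw [leading, TwoSidedIdeal.mem_mk']
  rfl

theorem map_mem_leading (H : IsSkewCoeff σ ι u c) (J : TwoSidedIdeal R) (S : Set G) (h : G)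
    (a : A) (ha : a ∈ H.leading J S) : σ h a ∈ H.leading J S := by
  rw [mem_leading] at ha ⊢
  obtain ⟨y, hy, hyS, rfl⟩ := ha
  exact ⟨u h * y * u h⁻¹, J.mul_mem_right _ _ (J.mul_mem_left _ _ hy),
    fun g hg => by simp [H.coeff_conj, hyS g hg], H.coeff_conj h y 1⟩

/-- If the coefficient ring is `G`-simple, every nonzero ideal contains a central element whose
coefficient at `1` is `1`. -/
theorem exists_mem_center (H : IsSkewCoeff σ ι u c)
    (hA : ∀ I : TwoSidedIdeal A, (∀ (g : G) (a : A), a ∈ I → σ g a ∈ I) → I = ⊥ ∨ I = ⊤)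
    {J : TwoSidedIdeal R} (hJ : J ≠ ⊥) : ∃ z ∈ J, z ∈ Subring.center R ∧ c z 1 = 1 := by
  obtain ⟨x, hx, hx1, hmin⟩ := H.exists_minimal_support hJ
  have hmem : c x 1 ∈ H.leading J {g | c x g ≠ 0} := by
    rw [mem_leading]
    exact ⟨x, hx, fun g hg => not_not.1 hg, rfl⟩
  obtain hbot | htop := hA _ (H.map_mem_leading J {g | c x g ≠ 0})
  · rw [hbot, TwoSidedIdeal.mem_bot] at hmem
    exact absurd hmem hx1
  have hone : (1 : A) ∈ H.leading J {g | c x g ≠ 0} := htop ▸ TwoSidedIdeal.mem_top _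
  rw [mem_leading] at hone
  obtain ⟨z, hz, hzS, hz1⟩ := hone
  replace hzS : ∀ g, c x g = 0 → c z g = 0 := fun g hg => hzS g (not_not.2 hg)
  refine ⟨z, hz, H.mem_center (fun a => ?_) (fun h => ?_), hz1⟩
  · refine sub_eq_zero.1 (hmin _ (J.sub_mem (J.mul_mem_right _ _ hz) (J.mul_mem_left _ _ hz))
      (fun g hg => ?_) ?_)
    · simp [H.coeff_mul_ι, H.coeff_ι_mul, hzS g hg]
    · simp [H.coeff_mul_ι, H.coeff_ι_mul, hz1]
  · have hconj : u h * z * u h⁻¹ = z := by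
      refine sub_eq_zero.1 (hmin _
        (J.sub_mem (J.mul_mem_right _ _ (J.mul_mem_left _ _ hz)) hz) (fun g hg => ?_) ?_)
      · simp [H.coeff_conj, hzS g hg]
      · simp [H.coeff_conj, hz1]
    rw [← H.mul_u_inv_cancel (u h * z) h, hconj]

theorem isSimpleRing (H : IsSkewCoeff σ ι u c)
    (hA : ∀ I : TwoSidedIdeal A, (∀ (g : G) (a : A), a ∈ I → σ g a ∈ I) → I = ⊥ ∨ I = ⊤)
    (hZ : IsField (Subring.center R)) : IsSimpleRing R := by
  have : Nontrivial R := by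
    obtain ⟨x, y, hxy⟩ := hZ.exists_pair_ne
    exact ⟨x, y, fun h => hxy (Subtype.ext h)⟩
  have := nontrivial_of_addEquiv c
  refine ⟨⟨fun J => or_iff_not_imp_left.2 fun hJ => ?_⟩⟩
  obtain ⟨z, hz, hzc, hz1⟩ := H.exists_mem_center hA hJ
  have hz0 : (⟨z, hzc⟩ : Subring.center R) ≠ 0 := by
    intro h
    have hz0 : z = 0 := congrArg Subtype.val h
    simp [hz0] at hz1
  obtain ⟨w, hw⟩ := hZ.mul_inv_cancel hz0
  have hw' : z * w = 1 := congrArg Subtype.val hw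
  exact J.one_mem_iff.1 (hw' ▸ J.mul_mem_right _ _ hz)

theorem eq_one_of_isField_center (H : IsSkewCoeff σ ι u c) [Nontrivial R]
    (hZ : IsField (Subring.center R)) {g : G} (hg : ∀ a, σ g a = a) : g = 1 := by
  have := nontrivial_of_addEquiv c
  have hc : u g - 1 ∈ Subring.center R := by
    refine sub_mem (H.mem_center (fun a => ?_) fun h => ?_) (one_mem _)
    · rw [H.comm, hg]
    · rw [H.mul, H.mul, mul_comm]
  by_cases h0 : u g - 1 = 0
  · have h1 := congrArg c (sub_eq_zero.1 h0)
    rw [H.coeff_u, H.coeff_one] at h1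
    exact Finsupp.single_left_injective one_ne_zero h1
  · obtain ⟨w, hw⟩ := hZ.mul_inv_cancel (a := ⟨u g - 1, hc⟩) fun h => h0 (congrArg Subtype.val h)
    rw [hZ.mul_comm] at hw
    have hw' : (w : R) * u g = w + 1 := by
      rw [← sub_eq_iff_eq_add', ← mul_sub_one]
      exact congrArg Subtype.val hw
    have hsum := H.sum_coeff_mul_u w g
    rw [hw', map_add, Finsupp.sum_add_index' (by simp) (by simp), H.coeff_one,
      Finsupp.sum_single_index rfl] at hsum
    exact absurd (add_eq_left.1 hsum) one_ne_zero

end CommGroup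

end IsSkewCoeff

theorem exists_isSkewCoeff {A : Type*} [Ring A] {G : Type*} [Group G] (σ : G →* RingAut A)
    {R : Type*} [Ring R] (ι : A →+* R) (u : G → R) (hu_one : u 1 = 1)
    (hu_mul : ∀ g h : G, u g * u h = u (g * h))
    (hu_comm : ∀ (g : G) (a : A), u g * ι a = ι (σ g a) * u g)
    (hfree : Function.Bijective (fun x : G →₀ A => x.sum fun g a => ι a * u g)) :
    ∃ c : R ≃+ (G →₀ A), IsSkewCoeff σ ι u c := by
  let Φ : (G →₀ A) →+ R :=
    Finsupp.liftAddHom fun g => (AddMonoidHom.mulRight (u g)).comp ι.toAddMonoidHom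
  have hΦ : Function.Bijective Φ := hfree
  refine ⟨(AddEquiv.ofBijective Φ hΦ).symm, hu_one, hu_mul, hu_comm, fun a g => ?_⟩
  rw [AddEquiv.symm_apply_eq]
  simp [Φ]

/-- Let an abelian group `G` act on a unital ring `A` by ring
automorphisms via `σ : G →* RingAut A`. Then the skew group algebra `A ⋊^σ G`
(modelled as a ring `R` with `ι : A →+* R`, elements `u g`, the skew commutation
relation and freeness) is a simple ring if and only if: (1) `A` is `G`-simple;
(2) the center `Z(A ⋊^σ G)` is a field; and (3) `σ` has trivial kernel. -/
theorem skew_group_algebra_simple_iff_abelian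
    {A : Type*} [Ring A] {G : Type*} [CommGroup G] (σ : G →* RingAut A)
    {R : Type*} [Ring R] (ι : A →+* R) (u : G → R)
    (hu_one : u 1 = 1)
    (hu_mul : ∀ g h : G, u g * u h = u (g * h))
    (hu_comm : ∀ (g : G) (a : A), u g * ι a = ι (σ g a) * u g)
    (hfree : Function.Bijective
      (fun x : G →₀ A => x.sum fun g a => ι a * u g)) :
    IsSimpleRing R ↔
      ((∀ I : TwoSidedIdeal A,
          (∀ (g : G) (a : A), a ∈ I → σ g a ∈ I) → I = ⊥ ∨ I = ⊤) ∧
        IsField (Subring.center R) ∧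
        (∀ g : G, (∀ a : A, σ g a = a) → g = 1)) := by
  obtain ⟨c, H⟩ := exists_isSkewCoeff σ ι u hu_one hu_mul hu_comm hfree
  refine ⟨fun _ => ?_, fun h => H.isSimpleRing h.1 h.2.1⟩
  have hZ := IsSimpleRing.isField_center R
  exact ⟨H.eq_bot_or_eq_top_of_isSimpleRing, hZ, fun g hg => H.eq_one_of_isField_center hZ hg⟩
end

section
/- Let G be a group acting on a commutative unital ring A by ring automorphisms via σ : G → Aut(A). Then the skew group algebra A ⋊^σ G is a simple ring if and only if all of the following hold: (1) A is G-simple; (2) the center Z(A ⋊^σ G) is a field; (3) σ has trivial kernel, i.e. σ(g) = id_A implies g = e; and (4) the subring A u_e is maximal commutative in A ⋊^σ G. -/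
/-- The data `ι : A →+* R`, `u : G → R` exhibits `R` as the skew group algebra `A ⋊^σ G`. -/
structure IsSkewGroupAlgebra {A : Type*} [CommRing A] {G : Type*} [Group G] (σ : G →* RingAut A)
    {R : Type*} [Ring R] (ι : A →+* R) (u : G → R) : Prop where
  one : u 1 = 1
  mul : ∀ g h : G, u g * u h = u (g * h)
  comm : ∀ (g : G) (a : A), u g * ι a = ι (σ g a) * u g
  free : Function.Bijective (fun x : G →₀ A => x.sum fun g a => ι a * u g)

namespace IsSkewGroupAlgebra

variable {A : Type*} [CommRing A] {G : Type*} [Group G] {σ : G →* RingAut A}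
  {R : Type*} [Ring R] {ι : A →+* R} {u : G → R}

/-- The additive map sending a finitely supported family of coefficients to `∑ ι a * u g`. -/
noncomputable def ofCoeff (ι : A →+* R) (u : G → R) : (G →₀ A) →+ R :=
  Finsupp.liftAddHom fun g => (AddMonoidHom.mulRight (u g)).comp ι.toAddMonoidHom

omit [Group G] in
lemma ofCoeff_single (g : G) (a : A) : ofCoeff ι u (Finsupp.single g a) = ι a * u g := by
  simp [ofCoeff]

lemma ofCoeff_bijective (S : IsSkewGroupAlgebra σ ι u) : Function.Bijective (ofCoeff ι u) :=
  S.free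

/-- The family of coefficients of an element of a skew group algebra. -/
noncomputable def coeff (S : IsSkewGroupAlgebra σ ι u) : R ≃+ (G →₀ A) :=
  (AddEquiv.ofBijective (ofCoeff ι u) S.ofCoeff_bijective).symm

variable (S : IsSkewGroupAlgebra σ ι u)
include S

lemma coeff_monomial (g : G) (a : A) : S.coeff (ι a * u g) = Finsupp.single g a := by
  rw [coeff, AddEquiv.symm_apply_eq, AddEquiv.ofBijective_apply, ofCoeff_single]

lemma coeff_base (a : A) : S.coeff (ι a) = Finsupp.single 1 a := by
  rw [← S.coeff_monomial, S.one, mul_one]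

lemma coeff_u (g : G) : S.coeff (u g) = Finsupp.single g 1 := by
  rw [← S.coeff_monomial, map_one, one_mul]

lemma induction {P : R → Prop} (zero : P 0) (add : ∀ r s, P r → P s → P (r + s))
    (monomial : ∀ g a, P (ι a * u g)) (r : R) : P r := by
  obtain ⟨x, rfl⟩ := S.ofCoeff_bijective.2 r
  induction x using Finsupp.induction_linear with
  | zero => simpa using zero
  | add x y hx hy => simpa using add _ _ hx hy
  | single g a => simpa [ofCoeff_single] using monomial g a

lemma monomial_mul_monomial (a b : A) (g h : G) :
    (ι a * u g) * (ι b * u h) = ι (a * σ g b) * u (g * h) := by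
  rw [map_mul, ← S.mul, mul_assoc, ← mul_assoc (u g), S.comm, mul_assoc, mul_assoc]

lemma coeff_base_mul (a : A) (r : R) (g : G) : S.coeff (ι a * r) g = a * S.coeff r g := by
  induction r using S.induction with
  | zero => simp
  | add r s hr hs => simp [mul_add, hr, hs]
  | monomial h b =>
    rw [← mul_assoc, ← map_mul, coeff_monomial, coeff_monomial]
    by_cases hg : h = g <;> simp [hg]

lemma coeff_mul_base (a : A) (r : R) (g : G) : S.coeff (r * ι a) g = S.coeff r g * σ g a := by
  induction r using S.induction with
  | zero => simp
  | add r s hr hs => simp [add_mul, hr, hs]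
  | monomial h b =>
    rw [mul_assoc, S.comm, ← mul_assoc, ← map_mul, coeff_monomial, coeff_monomial]
    by_cases hg : h = g <;> simp [hg]

lemma coeff_mul_u (h : G) (r : R) (g : G) : S.coeff (r * u h) g = S.coeff r (g * h⁻¹) := by
  induction r using S.induction with
  | zero => simp
  | add r s hr hs => simp [add_mul, hr, hs]
  | monomial k b =>
    rw [mul_assoc, S.mul, coeff_monomial, coeff_monomial]
    classical
    simp only [Finsupp.single_apply, eq_mul_inv_iff_mul_eq]

lemma eq_base_of_coeff_eq_zero {r : R} (hr : ∀ g ≠ 1, S.coeff r g = 0) :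
    r = ι (S.coeff r 1) := by
  apply S.coeff.injective
  rw [coeff_base]
  ext g
  by_cases hg : g = 1
  · simp [hg]
  · simp [hr g hg, Ne.symm hg]

/-- The action of a skew group algebra on its base ring, in which `ι a * u g` sends `b` to
`a * σ g b`. -/
noncomputable def act : R →+ A →+ A :=
  (Finsupp.liftAddHom fun g => AddMonoidHom.mul.compl₂ (σ g : A →+* A).toAddMonoidHom).comp
    S.coeff.toAddMonoidHom

lemma act_monomial (a b : A) (g : G) : S.act (ι a * u g) b = a * σ g b := by
  simp [act, coeff_monomial]

lemma act_base (a b : A) : S.act (ι a) b = a * b := by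
  simpa [S.one] using S.act_monomial a b 1

lemma act_mul (r s : R) (b : A) : S.act (r * s) b = S.act r (S.act s b) := by
  induction r using S.induction with
  | zero => simp
  | add r r' hr hr' => simp [add_mul, hr, hr']
  | monomial g a =>
    induction s using S.induction with
    | zero => simp
    | add s s' hs hs' => simp [mul_add, hs, hs']
    | monomial h c =>
      rw [S.monomial_mul_monomial]
      simp only [act_monomial, map_mul (σ g), map_mul σ, RingAut.mul_apply, mul_assoc]

lemma act_mem {I : Ideal A} (hI : ∀ (g : G) (a : A), a ∈ I → σ g a ∈ I) (r : R) {b : A}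
    (hb : b ∈ I) : S.act r b ∈ I := by
  induction r using S.induction with
  | zero => simp
  | add r s hr hs => simpa using I.add_mem hr hs
  | monomial g a => simpa [act_monomial] using I.mul_mem_left a (hI g b hb)

/-- The annihilator in a skew group algebra of the quotient of the base ring by an invariant
ideal. -/
noncomputable def annihilator (I : Ideal A) (hI : ∀ (g : G) (a : A), a ∈ I → σ g a ∈ I) :
    TwoSidedIdeal R :=
  .mk' {r | ∀ b, S.act r b ∈ I} (by simp)
    (fun hr hs b => by simpa using I.add_mem (hr b) (hs b))
    (fun hr b => by simpa using hr b)
    (fun hs b => by simpa [act_mul] using S.act_mem hI _ (hs b))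
    (fun hr b => by simpa [act_mul] using hr _)

lemma mem_annihilator {I : Ideal A} (hI : ∀ (g : G) (a : A), a ∈ I → σ g a ∈ I) {r : R} :
    r ∈ S.annihilator I hI ↔ ∀ b, S.act r b ∈ I := by
  simp [annihilator, TwoSidedIdeal.mem_mk']

/-- In a simple skew group algebra, an element acting on the base ring with values in a proper
invariant ideal vanishes. -/
lemma eq_zero_of_act_mem [IsSimpleRing R] {I : Ideal A}
    (hI : ∀ (g : G) (a : A), a ∈ I → σ g a ∈ I) (hne : I ≠ ⊤) {r : R}
    (hr : ∀ b, S.act r b ∈ I) : r = 0 := by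
  rcases eq_bot_or_eq_top (S.annihilator I hI) with h | h
  · rw [← TwoSidedIdeal.mem_bot, ← h, mem_annihilator]
    exact hr
  · have h1 : ι 1 ∈ S.annihilator I hI := h ▸ trivial
    rw [mem_annihilator] at h1
    exact absurd ((Ideal.eq_top_iff_one I).2 (by simpa only [act_base, mul_one] using h1 1)) hne

lemma injective_base : Function.Injective ι := fun a b h => by
  simpa [coeff_base] using congrArg (fun r => S.coeff r 1) h

lemma isGSimple [IsSimpleRing R] (I : Ideal A) (hI : ∀ (g : G) (a : A), a ∈ I → σ g a ∈ I) :
    I = ⊥ ∨ I = ⊤ := by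
  refine or_iff_not_imp_right.2 fun hne => (Submodule.eq_bot_iff I).2 fun a ha => ?_
  apply S.injective_base
  rw [map_zero]
  exact S.eq_zero_of_act_mem hI hne fun b => by
    simpa [act_base] using I.mul_mem_right b ha

lemma centralizer_base_eq [IsSimpleRing R] :
    {r : R | ∀ a : A, r * ι a = ι a * r} = Set.range ι := by
  have := ι.domain_nontrivial
  ext r
  constructor
  · intro hr
    refine ⟨_, (S.eq_base_of_coeff_eq_zero fun g hg => ?_).symm⟩
    have hc (a : A) : S.coeff r g * σ g a = a * S.coeff r g := by
      rw [← coeff_mul_base, hr a, coeff_base_mul]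
    have h0 : ι (S.coeff r g) * u g - ι (S.coeff r g) = 0 :=
      S.eq_zero_of_act_mem (I := ⊥) (by simp) bot_ne_top fun b => by
        simp [act_base, act_monomial, hc, mul_comm]
    simpa [coeff_monomial, coeff_base, Ne.symm hg] using congrArg (fun r => S.coeff r g) h0
  · rintro ⟨b, rfl⟩ a
    rw [← map_mul, mul_comm, map_mul]

lemma eq_one_of_centralizer_base_eq [Nontrivial R]
    (hmax : {r : R | ∀ a : A, r * ι a = ι a * r} = Set.range ι) {g : G}
    (hg : ∀ a : A, σ g a = a) : g = 1 := by
  have := ι.domain_nontrivial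
  have hu : u g ∈ {r : R | ∀ a : A, r * ι a = ι a * r} := fun a => by rw [S.comm, hg]
  rw [hmax] at hu
  obtain ⟨b, hb⟩ := hu
  by_contra hne
  simpa [coeff_base, coeff_u, Ne.symm hne] using congrArg (fun r => S.coeff r g) hb

/-- If the base ring is maximal commutative, every nonzero two-sided ideal meets it
nontrivially. -/
lemma exists_base_mem (hmax : {r : R | ∀ a : A, r * ι a = ι a * r} = Set.range ι)
    {J : TwoSidedIdeal R} (hJ : J ≠ ⊥) : ∃ a : A, a ≠ 0 ∧ ι a ∈ J := by
  have hex : ∃ n, ∃ r ∈ J, S.coeff r 1 ≠ 0 ∧ (S.coeff r).support.card = n := by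
    obtain ⟨r, hr, hr0⟩ : ∃ r ∈ J, r ≠ 0 := by
      by_contra! h
      exact hJ (le_bot_iff.1 fun r hr => (TwoSidedIdeal.mem_bot R).2 (h r hr))
    obtain ⟨g, hg⟩ := Finsupp.ne_iff.1 (S.coeff.map_ne_zero_iff.2 hr0)
    exact ⟨_, r * u g⁻¹, J.mul_mem_right _ _ hr, by simpa [coeff_mul_u] using hg, rfl⟩
  classical
  obtain ⟨r, hr, hr1, hcard⟩ := Nat.find_spec hex
  have hmin : ∀ s ∈ J, (S.coeff s).support ⊂ (S.coeff r).support → s = 0 := by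
    intro s hs hlt
    by_contra hs0
    obtain ⟨g, hg⟩ := Finsupp.ne_iff.1 (S.coeff.map_ne_zero_iff.2 hs0)
    have hle : (S.coeff (s * u g⁻¹)).support.card ≤ (S.coeff s).support.card :=
      Finset.card_le_card_of_injOn (· * g)
        (fun k hk => by simpa [coeff_mul_u] using hk) (mul_left_injective g).injOn
    exact Nat.find_min hex (hle.trans_lt (hcard ▸ Finset.card_lt_card hlt))
      ⟨s * u g⁻¹, J.mul_mem_right _ _ hs, by simpa [coeff_mul_u] using hg, rfl⟩
  have hcomm : r ∈ {r : R | ∀ a : A, r * ι a = ι a * r} := fun a => by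
    have hc (g : G) : S.coeff (r * ι a - ι a * r) g =
        S.coeff r g * σ g a - a * S.coeff r g := by
      simp [coeff_mul_base, coeff_base_mul]
    refine sub_eq_zero.1 (hmin _ (J.sub_mem (J.mul_mem_right _ _ hr) (J.mul_mem_left _ _ hr)) ?_)
    refine (Finset.ssubset_iff_of_subset fun g hg => ?_).2 ⟨1, by simpa using hr1, ?_⟩
    · rw [Finsupp.mem_support_iff, hc] at hg
      exact Finsupp.mem_support_iff.2 fun h0 => hg (by simp [h0])
    · rw [Finsupp.notMem_support_iff, hc]
      simp [mul_comm]
  rw [hmax] at hcomm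
  obtain ⟨a, rfl⟩ := hcomm
  exact ⟨a, by simpa [coeff_base] using hr1, hr⟩

lemma isSimpleRing [Nontrivial R]
    (hA : ∀ I : Ideal A, (∀ (g : G) (a : A), a ∈ I → σ g a ∈ I) → I = ⊥ ∨ I = ⊤)
    (hmax : {r : R | ∀ a : A, r * ι a = ι a * r} = Set.range ι) : IsSimpleRing R := by
  refine ⟨⟨fun J => or_iff_not_imp_left.2 fun hJ => ?_⟩⟩
  obtain ⟨a, ha0, ha⟩ := S.exists_base_mem hmax hJ
  have hI (g : G) (b : A) (hb : b ∈ J.asIdeal.comap ι) : σ g b ∈ J.asIdeal.comap ι := by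
    have h : ι (σ g b) = u g * ι b * u g⁻¹ := by
      rw [S.comm, mul_assoc, S.mul, mul_inv_cancel, S.one, mul_one]
    simp only [Ideal.mem_comap, TwoSidedIdeal.mem_asIdeal] at hb ⊢
    rw [h]
    exact J.mul_mem_right _ _ (J.mul_mem_left _ _ hb)
  rcases hA _ hI with h | h
  · refine absurd ?_ ha0
    rw [← Ideal.mem_bot, ← h]
    simpa using ha
  · have h1 : (1 : A) ∈ J.asIdeal.comap ι := h ▸ trivial
    exact (TwoSidedIdeal.one_mem_iff J).1 (by simpa using h1)

end IsSkewGroupAlgebra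


/-- Let a group `G` act on a commutative unital ring `A` by ring
automorphisms via `σ : G →* RingAut A`. Then the skew group algebra `A ⋊^σ G`
(modelled as a ring `R` with `ι : A →+* R`, elements `u g`, the skew commutation
relation and freeness) is a simple ring if and only if: (1) `A` is `G`-simple;
(2) the center `Z(A ⋊^σ G)` is a field; (3) `σ` has trivial kernel; and
(4) the subring `A u_e = range ι` is maximal commutative in `A ⋊^σ G`. -/
theorem skew_group_algebra_simple_iff_commutative_base
    {A : Type*} [CommRing A] {G : Type*} [Group G] (σ : G →* RingAut A)
    {R : Type*} [Ring R] (ι : A →+* R) (u : G → R)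
    (hu_one : u 1 = 1)
    (hu_mul : ∀ g h : G, u g * u h = u (g * h))
    (hu_comm : ∀ (g : G) (a : A), u g * ι a = ι (σ g a) * u g)
    (hfree : Function.Bijective
      (fun x : G →₀ A => x.sum fun g a => ι a * u g)) :
    IsSimpleRing R ↔
      ((∀ I : Ideal A, (∀ (g : G) (a : A), a ∈ I → σ g a ∈ I) → I = ⊥ ∨ I = ⊤) ∧
        IsField (Subring.center R) ∧
        (∀ g : G, (∀ a : A, σ g a = a) → g = 1) ∧
        {r : R | ∀ a : A, r * ι a = ι a * r} = Set.range ι) := by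
  have S : IsSkewGroupAlgebra σ ι u := ⟨hu_one, hu_mul, hu_comm, hfree⟩
  constructor
  · intro _
    have hmax := S.centralizer_base_eq
    exact ⟨S.isGSimple, IsSimpleRing.isField_center R,
      fun _ => S.eq_one_of_centralizer_base_eq hmax, hmax⟩
  · rintro ⟨hA, hZ, -, hmax⟩
    have := hZ.nontrivial
    have : Nontrivial R := (Subring.center R).subtype_injective.nontrivial
    exact S.isSimpleRing hA hmax
end

section
/- Let G be a group acting on a unital ring A by ring automorphisms via σ : G → Aut(A), and let N = ker(σ) = {n ∈ G : σ(n) = id_A}. Let x = Σ_{n ∈ N} a_n u_n be an element of the skew group algebra A ⋊^σ G whose support is contained in N (with a_n ∈ A, all but finitely many zero) and which satisfies Σ_{n ∈ N} a_n = 0. Then the two-sided ideal of A ⋊^σ G generated by x has zero intersection with the subring A u_e. In particular, if there exists a nonidentity n ∈ G with σ(n) = id_A, then A ⋊^σ G is not simple. -/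
/-- An additive equivalence between finitely supported functions `G →₀ A` and `R`, built from
freeness of the elements `u g`. -/
noncomputable def skewCoeffEquiv {A G R : Type*} [Ring A] [Ring R] (ι : A →+* R) (u : G → R)
    (hfree : Function.Bijective
      (fun x : G →₀ A => x.sum fun g a => ι a * u g)) : (G →₀ A) ≃+ R :=
  AddEquiv.ofBijective
    (Finsupp.liftAddHom fun g => (AddMonoidHom.mulRight (u g)).comp ι.toAddMonoidHom) hfree

theorem skewCoeffEquiv_single {A G R : Type*} [Ring A] [Ring R] (ι : A →+* R) (u : G → R)
    (hfree : Function.Bijective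
      (fun x : G →₀ A => x.sum fun g a => ι a * u g)) (g : G) (a : A) :
    skewCoeffEquiv ι u hfree (Finsupp.single g a) = ι a * u g := by
  simp [skewCoeffEquiv]

/-- The skew group ring acts on its base ring by letting `ι a * u g` act as
`b ↦ a * σ g b`. -/
theorem exists_skewGroupRing_action
    {A : Type*} [Ring A] {G : Type*} [Group G] (σ : G →* RingAut A)
    {R : Type*} [Ring R] (ι : A →+* R) (u : G → R)
    (hu_one : u 1 = 1)
    (hu_mul : ∀ g h : G, u g * u h = u (g * h))
    (hu_comm : ∀ (g : G) (a : A), u g * ι a = ι (σ g a) * u g)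
    (hfree : Function.Bijective
      (fun x : G →₀ A => x.sum fun g a => ι a * u g)) :
    ∃ φ : R →+* AddMonoid.End A, ∀ a g b, φ (ι a * u g) b = a * σ g b := by
  let e := skewCoeffEquiv ι u hfree
  let act : G → A →+ AddMonoid.End A := fun g =>
    (AddMonoidHom.mulRight (R := AddMonoid.End A)
      (σ g : A ≃+* A).toAddEquiv.toAddMonoidHom).comp AddMonoid.End.mulLeft
  let f : R →+ AddMonoid.End A := (Finsupp.liftAddHom act).comp e.symm.toAddMonoidHom
  have hf : ∀ a g b, f (ι a * u g) b = a * σ g b := by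
    intro a g b
    have h : e.symm (ι a * u g) = Finsupp.single g a := by
      rw [AddEquiv.symm_apply_eq, skewCoeffEquiv_single]
    change Finsupp.liftAddHom act (e.symm (ι a * u g)) b = _
    rw [h, Finsupp.liftAddHom_apply_single]
    rfl
  have h_one : f 1 = 1 := by
    ext b
    simpa [hu_one] using hf 1 1 b
  have h_ind : ∀ p : R → Prop, ∀ (zero : p 0) (plus : ∀ x y, p x → p y → p (x + y))
      (single : ∀ a g, p (ι a * u g)) (r : R), p r := by
    intro p h_zero h_add h_single r
    obtain ⟨x, rfl⟩ := e.surjective r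
    induction x using Finsupp.induction_linear with
    | zero => simpa using h_zero
    | add x y hx hy => simpa using h_add _ _ hx hy
    | single g a => simpa only [e, skewCoeffEquiv_single] using h_single a g
  have h_mul : ∀ x y, f (x * y) = f x * f y := by
    intro x y
    induction x using h_ind with
    | zero => simp
    | plus x₁ x₂ h₁ h₂ => rw [add_mul, map_add, map_add, h₁, h₂, add_mul]
    | single a g =>
      induction y using h_ind with
      | zero => simp
      | plus y₁ y₂ h₁ h₂ => rw [mul_add, map_add, map_add, h₁, h₂, mul_add]
      | single c k =>
        have h : ι a * u g * (ι c * u k) = ι (a * σ g c) * u (g * k) := by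
          rw [map_mul, ← hu_mul, mul_assoc, ← mul_assoc (u g), hu_comm]
          simp only [mul_assoc]
        ext b
        rw [h, hf, AddMonoid.End.coe_mul, Function.comp_apply, hf, hf]
        simp [mul_assoc]
  exact ⟨{ f with map_one' := h_one, map_mul' := h_mul }, hf⟩

/-- Let a group `G` act on a unital ring `A` by ring automorphisms
via `σ : G →* RingAut A`, and let `N = ker σ`. In the skew group algebra `A ⋊^σ G`
(modelled as a ring `R` with `ι : A →+* R`, elements `u g`, the skew commutation
relation and freeness): if `x = Σ_{n ∈ N} a_n u_n` has support contained in `N` and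
`Σ a_n = 0`, then the two-sided ideal generated by `x` meets the subring
`A u_e = range ι` only in `0`. In particular, if some nonidentity `n` has
`σ(n) = id_A`, then `A ⋊^σ G` is not simple. -/
theorem ideal_generated_by_kernel_element_meets_base_trivially
    {A : Type*} [Ring A] {G : Type*} [Group G] (σ : G →* RingAut A)
    {R : Type*} [Ring R] (ι : A →+* R) (u : G → R)
    (hu_one : u 1 = 1)
    (hu_mul : ∀ g h : G, u g * u h = u (g * h))
    (hu_comm : ∀ (g : G) (a : A), u g * ι a = ι (σ g a) * u g)
    (hfree : Function.Bijective
      (fun x : G →₀ A => x.sum fun g a => ι a * u g)) :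
    (∀ a : G →₀ A, (∀ n ∈ a.support, ∀ b : A, σ n b = b) →
      (a.sum fun _ c => c) = 0 →
      ∀ r ∈ TwoSidedIdeal.span {a.sum fun g c => ι c * u g},
        r ∈ Set.range ι → r = 0) ∧
    ((∃ n : G, n ≠ 1 ∧ ∀ b : A, σ n b = b) → ¬ IsSimpleRing R) := by
  obtain ⟨φ, hφ⟩ := exists_skewGroupRing_action σ ι u hu_one hu_mul hu_comm hfree
  have h_inter : ∀ a : G →₀ A, (∀ n ∈ a.support, ∀ b : A, σ n b = b) →
      (a.sum fun _ c => c) = 0 →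
      ∀ r ∈ TwoSidedIdeal.span {a.sum fun g c => ι c * u g},
        r ∈ Set.range ι → r = 0 := by
    rintro a ha h_sum r hr ⟨c, rfl⟩
    have h_le : TwoSidedIdeal.span {a.sum fun g c => ι c * u g} ≤ TwoSidedIdeal.ker φ := by
      rw [TwoSidedIdeal.span_le, Set.singleton_subset_iff, SetLike.mem_coe,
        TwoSidedIdeal.mem_ker]
      ext b
      rw [Finsupp.sum, map_sum]
      refine (AddMonoidHom.finsetSum_apply (M := A) (N := A) _ _ b).trans ?_
      calc ∑ g ∈ a.support, φ (ι (a g) * u g) b = ∑ g ∈ a.support, a g * b :=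
            Finset.sum_congr rfl fun g hg => by rw [hφ, ha g hg]
        _ = (a.sum fun _ c => c) * b := (Finset.sum_mul ..).symm
        _ = 0 := by rw [h_sum, zero_mul]
    have hc : φ (ι c) = 0 := (TwoSidedIdeal.mem_ker φ).1 (h_le hr)
    have h : c = 0 := by
      simpa [hu_one, hc] using (hφ c 1 1).symm
    rw [h, map_zero]
  refine ⟨h_inter, ?_⟩
  rintro ⟨n, hn, hσ⟩ h_simple
  let a : G →₀ A := Finsupp.single n 1 - Finsupp.single 1 1
  have ha : ∀ m ∈ a.support, ∀ b : A, σ m b = b := by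
    classical
    intro m hm b
    have hm' := Finsupp.support_sub hm
    rcases Finset.mem_union.1 hm' with h | h
    · rw [Finset.mem_singleton.1 (Finsupp.support_single_subset h), hσ]
    · rw [Finset.mem_singleton.1 (Finsupp.support_single_subset h), map_one, RingAut.one_apply]
  have h_sum : (a.sum fun _ c => c) = 0 := by
    rw [Finsupp.sum_sub_index (by simp)]
    simp
  have h_top : TwoSidedIdeal.span {a.sum fun g c => ι c * u g} = ⊤ := by
    refine (eq_bot_or_eq_top _).resolve_left fun h_bot => ?_
    have hx : (a.sum fun g c => ι c * u g) = 0 := by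
      rw [← TwoSidedIdeal.mem_bot, ← h_bot]
      exact TwoSidedIdeal.subset_span rfl
    have h_zero : a = 0 := hfree.1 (by simpa using hx)
    have h_coeff : (1 : A) = 0 := by
      simpa [a, hn, Finsupp.single_apply, hn.symm] using DFunLike.congr_fun h_zero n
    exact one_ne_zero (α := R) (by rw [← map_one ι, h_coeff, map_zero])
  exact one_ne_zero (α := R) (h_inter a ha h_sum 1 (h_top ▸ trivial) ⟨1, map_one ι⟩)
end
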